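/- Let C : F(X,Y,Z) = 0 be a smooth projective plane curve of degree d ≥ 3 over a number field k (so of genus g ≥ 1). Then every rational geometric progression sequence on C is of finite length. -/

import Mathlib

open MvPolynomial

set_option synthInstance.maxHeartbeats 400000
set_option maxHeartbeats 1000000

noncomputable section

/-- `F` defines a smooth projective plane curve of degree `d` over `k`: it is homogeneous of
degree `d` and, over the algebraic closure of `k`, `F` and its partial derivatives have no
common nontrivial zero (the Jacobian criterion for smoothness of the plane curve `F = 0`). -/
def IsSmoothPlaneCurve {k : Type} [Field k] (d : ℕ) (F : MvPolynomial (Fin 3) k) : Prop :=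
  F.IsHomogeneous d ∧
    ∀ P : Fin 3 → AlgebraicClosure k, P ≠ 0 →
      ∃ i : Fin 3, eval P (map (algebraMap k (AlgebraicClosure k)) (pderiv i F)) ≠ 0

section Puiseux

open Polynomial

lemma coeff_taylor_natDegree_sub_one {R : Type*} [CommRing R] {f : R[X]} (hf : f.Monic) {n : ℕ}
    (hn : f.natDegree = n + 1) (r : R) :
    (taylor r f).coeff n = (n + 1) * r + f.coeff n := by
  have hd : (hasseDeriv n f).natDegree < 2 := by
    have := natDegree_hasseDeriv_le f n
    omega
  have h1 : f.coeff (n + 1) = 1 := by rw [← hn]; exact hf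
  rw [taylor_coeff, eval_eq_sum_range' hd]
  simp only [Finset.sum_range_succ, Finset.sum_range_zero, hasseDeriv_coeff]
  rw [show 1 + n = n + 1 by ring, h1]
  simp
  ring

lemma exists_monic_mul_of_map_constantCoeff_ne {K : Type*} [Field K] {h : (PowerSeries K)[X]}
    (hm : h.Monic) (h0 : PowerSeries.constantCoeff (h.coeff 0) = 0)
    (hne : h.map (PowerSeries.constantCoeff (R := K)) ≠ Polynomial.X ^ h.natDegree) :
    ∃ f q : (PowerSeries K)[X], f.Monic ∧ q.Monic ∧ h = f * q ∧ f.natDegree < h.natDegree ∧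
      q.natDegree < h.natDegree := by
  have hmax := PowerSeries.maximalIdeal_eq_span_X (k := K)
  have : IsAdicComplete (IsLocalRing.maximalIdeal (PowerSeries K)) (PowerSeries K) := by
    rw [hmax]; infer_instance
  have hmem : ∀ a : PowerSeries K, a ∈ IsLocalRing.maximalIdeal (PowerSeries K) ↔
      PowerSeries.constantCoeff a = 0 := fun a ↦ by
    rw [hmax, Ideal.mem_span_singleton, PowerSeries.X_dvd_iff]
  have hg : (h : PowerSeries (PowerSeries K)).map (IsLocalRing.residue (PowerSeries K)) ≠ 0 := by
    rw [← polynomial_map_coe, ne_eq, Polynomial.coe_eq_zero_iff]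
    exact (hm.map _).ne_zero
  obtain ⟨f, w, H⟩ := PowerSeries.exists_isWeierstrassFactorization hg
  have hfm := H.isDistinguishedAt.monic
  have hdeg := PowerSeries.IsWeierstrassFactorization.degree_eq_coe_lift_order_map H
  have hW := H.isDistinguishedAt.isWeierstrassDivisorAt'
  have hford : ((f : PowerSeries (PowerSeries K)).map (Ideal.Quotient.mk
      (IsLocalRing.maximalIdeal (PowerSeries K)))).order.toNat = f.natDegree := by
    rw [← polynomial_map_coe, H.isDistinguishedAt.map_eq_X_pow]
    simp
  have key := hW.eq_of_mul_add_eq_mul_add (q := (h /ₘ f : (PowerSeries K)[X])) (q' := w)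
    (r := h %ₘ f) (r' := 0) (by
      rw [hford, ← degree_eq_natDegree hfm.ne_zero]; exact degree_modByMonic_lt _ hfm) (by
      rw [degree_zero]; exact WithBot.bot_lt_coe _) (by
      rw [← Polynomial.coe_mul, ← Polynomial.coe_add, add_comm, modByMonic_add_div]
      rw [H.eq_mul]; simp)
  have hq : h = f * (h /ₘ f) := by
    conv_lhs => rw [← modByMonic_add_div h f, key.2, zero_add]
  have hqm : (h /ₘ f).Monic := hfm.of_mul_monic_left (hq ▸ hm)
  have hdegs : h.natDegree = f.natDegree + (h /ₘ f).natDegree := by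
    conv_lhs => rw [hq]
    exact hfm.natDegree_mul hqm
  refine ⟨f, h /ₘ f, hfm, hqm, hq, ?_, ?_⟩
  · rcases Nat.eq_zero_or_pos (h /ₘ f).natDegree with h1 | h1
    · rw [eq_one_of_monic_natDegree_zero hqm h1, mul_one] at hq
      refine absurd ?_ hne
      ext i
      rw [Polynomial.coeff_map, Polynomial.coeff_X_pow]
      split_ifs with hi
      · rw [hi, hm.coeff_natDegree, map_one]
      · rcases lt_or_gt_of_ne hi with hi | hi
        · rw [hq] at hi ⊢
          exact (hmem _).1 (H.isDistinguishedAt.mem hi)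
        · rw [coeff_eq_zero_of_natDegree_lt hi, map_zero]
    · omega
  · rcases Nat.eq_zero_or_pos f.natDegree with h1 | h1
    · have h2 := H.eq_mul
      rw [eq_one_of_monic_natDegree_zero hfm h1, Polynomial.coe_one, one_mul] at h2
      have h3 := PowerSeries.isUnit_iff_constantCoeff.1 H.isUnit
      rw [← h2, ← PowerSeries.coeff_zero_eq_constantCoeff_apply, Polynomial.coeff_coe] at h3
      exact absurd ((hmem _).2 h0) (by simpa using h3)
    · omega

/-- The substitution `X ↦ X ^ e` as a ring endomorphism of `K⟦X⟧`. -/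
def expandHom (K : Type*) [CommRing K] (e : ℕ) (he : e ≠ 0) :
    PowerSeries K →+* PowerSeries K :=
  (PowerSeries.expand (R := K) e he : PowerSeries K →ₐ[K] PowerSeries K).toRingHom

lemma expandHom_apply {K : Type*} [CommRing K] (e : ℕ) (he : e ≠ 0)
    (a : PowerSeries K) : expandHom K e he a = PowerSeries.expand e he a := rfl

/-- **Newton-Puiseux theorem** for monic polynomials over `K⟦X⟧`. -/
theorem exists_splits_map_expandHom {K : Type*} [Field K] [IsAlgClosed K] [CharZero K]
    (D : ℕ) : ∀ f : (PowerSeries K)[X], f.Monic → f.natDegree = D → ∃ (e : ℕ) (he : e ≠ 0),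
      (f.map (expandHom K e he)).Splits := by
  induction D using Nat.strong_induction_on with | _ D ih
  intro f hf hD
  obtain rfl | ⟨n, rfl⟩ : D = 0 ∨ ∃ n, D = n + 1 := by cases D <;> simp
  · refine ⟨1, one_ne_zero, ?_⟩
    rw [eq_one_of_monic_natDegree_zero hf hD]
    simp
  set r : PowerSeries K := PowerSeries.C (-((n : K) + 1)⁻¹) * f.coeff n with hr
  set g := taylor r f with hg
  have hgm : g.Monic := by rw [hg, Monic, leadingCoeff_taylor]; exact hf
  have hgd : g.natDegree = n + 1 := by rw [hg, natDegree_taylor, hD]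
  have hn0 : ((n : K) + 1) ≠ 0 := by exact_mod_cast Nat.succ_ne_zero n
  have hgn : g.coeff n = 0 := by
    rw [hg, coeff_taylor_natDegree_sub_one hf hD, hr]
    have : ((n : PowerSeries K) + 1) = PowerSeries.C ((n : K) + 1) := by simp
    rw [this, ← mul_assoc, ← map_mul, mul_neg, mul_inv_cancel₀ hn0]
    simp
  have hfg : f = taylor (-r) g := by rw [hg, taylor_taylor]; simp
  suffices ∃ (e : ℕ) (he : e ≠ 0),
      (g.map (expandHom K e he)).Splits by
    obtain ⟨e, he, h⟩ := this
    refine ⟨e, he, ?_⟩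
    rw [hfg, map_taylor]
    exact h.taylor _
  by_cases hX : g = Polynomial.X ^ (n + 1)
  · refine ⟨1, one_ne_zero, ?_⟩
    rw [hX, Polynomial.map_pow, Polynomial.map_X]
    exact Splits.X_pow _
  classical
  -- the steepest slope of the Newton polygon
  have hS : ((Finset.range (n + 1)).filter fun j ↦ g.coeff j ≠ 0).Nonempty := by
    by_contra hcon
    rw [Finset.not_nonempty_iff_eq_empty, Finset.filter_eq_empty_iff] at hcon
    refine hX ?_
    rw [hgm.as_sum, hgd, Finset.sum_eq_zero, add_zero]
    intro i hi
    rw [not_not.1 (hcon hi)]; simp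
  obtain ⟨j₀, hj₀, hmin⟩ := Finset.exists_min_image _
    (fun j ↦ ((g.coeff j).order.toNat : ℚ) / ((n + 1 - j : ℕ) : ℚ)) hS
  rw [Finset.mem_filter, Finset.mem_range] at hj₀
  set i₀ := n + 1 - j₀ with hi₀
  set p := (g.coeff j₀).order.toNat with hp
  have hi₀0 : i₀ ≠ 0 := by omega
  have hdvd : ∀ j < n + 1, ∃ b, expandHom K i₀ hi₀0 (g.coeff j) =
      PowerSeries.X ^ ((n + 1 - j) * p) * b := by
    intro j hj
    by_cases h0 : g.coeff j = 0
    · exact ⟨0, by simp [h0]⟩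
    have h1 := hmin j (by simp [hj, h0])
    have h2 : (0 : ℚ) < ((n + 1 - j : ℕ) : ℚ) := by exact_mod_cast (by omega)
    have h3 : (0 : ℚ) < (i₀ : ℚ) := by exact_mod_cast (by omega)
    rw [div_le_div_iff₀ h3 h2] at h1
    have h4 : p * (n + 1 - j) ≤ (g.coeff j).order.toNat * i₀ := by exact_mod_cast h1
    obtain ⟨c, hc⟩ := PowerSeries.X_pow_order_dvd (φ := g.coeff j)
    refine dvd_trans (pow_dvd_pow _ (by linarith :
      (n + 1 - j) * p ≤ i₀ * (g.coeff j).order.toNat)) ⟨expandHom K i₀ hi₀0 c, ?_⟩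
    conv_lhs => rw [hc]
    rw [map_mul, map_pow, expandHom_apply _ _ PowerSeries.X, PowerSeries.expand_X, ← pow_mul]
  choose! b hb using hdvd
  set h : (PowerSeries K)[X] := Polynomial.X ^ (n + 1) + ∑ j ∈ Finset.range (n + 1), Polynomial.C (b j) * Polynomial.X ^ j with hh
  have hlt : (∑ j ∈ Finset.range (n + 1), Polynomial.C (b j) * Polynomial.X ^ j).degree < ((n + 1 : ℕ) : WithBot ℕ) := by
    refine (degree_sum_le _ _).trans_lt ?_
    refine (Finset.sup_lt_iff (WithBot.bot_lt_coe _)).2 fun j hj ↦ ?_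
    exact (degree_C_mul_X_pow_le _ _).trans_lt (by exact_mod_cast Finset.mem_range.1 hj)
  have hhm : h.Monic := monic_X_pow_add hlt
  have hhd : h.natDegree = n + 1 := by
    refine natDegree_eq_of_degree_eq_some ?_
    rw [hh, degree_add_eq_left_of_degree_lt (by rwa [degree_X_pow]), degree_X_pow]
  have hhc : ∀ j < n + 1, h.coeff j = b j := by
    intro j hj
    rw [hh, Polynomial.coeff_add, Polynomial.coeff_X_pow, if_neg hj.ne, zero_add, finsetSum_coeff]
    simp only [coeff_C_mul_X_pow]
    rw [Finset.sum_ite_eq, if_pos (Finset.mem_range.2 hj)]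
  have hscale : g.map (expandHom K i₀ hi₀0) =
      h.scaleRoots (PowerSeries.X ^ p) := by
    ext1 j
    rw [Polynomial.coeff_map, coeff_scaleRoots, hhd]
    rcases lt_trichotomy j (n + 1) with hj | hj | hj
    · rw [hhc j hj, hb j hj, ← pow_mul, mul_comm p, mul_comm]
    · have e1 : g.coeff j = 1 := by rw [hj, ← hgd]; exact hgm
      have e2 : h.coeff j = 1 := by rw [hj, ← hhd]; exact hhm
      rw [e1, e2, hj]; simp
    · rw [coeff_eq_zero_of_natDegree_lt (by omega), coeff_eq_zero_of_natDegree_lt (by omega)]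
      simp
  have hbn : b n = 0 := by
    have := hb n (by omega)
    rw [hgn, map_zero] at this
    exact (mul_eq_zero.1 this.symm).resolve_left (pow_ne_zero _ PowerSeries.X_ne_zero)
  have hbj₀ : PowerSeries.constantCoeff (b j₀) ≠ 0 := by
    have h1 := congrArg (PowerSeries.coeff (i₀ * p)) (hb j₀ hj₀.1)
    rw [expandHom_apply, PowerSeries.coeff_expand_mul, ← hi₀, PowerSeries.coeff_X_pow_mul', if_pos le_rfl,
      Nat.sub_self, PowerSeries.coeff_zero_eq_constantCoeff_apply] at h1
    rw [← h1]
    exact PowerSeries.coeff_order hj₀.2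
  suffices ∃ (e : ℕ) (he : e ≠ 0),
      (h.map (expandHom K e he)).Splits by
    obtain ⟨e, he, hs⟩ := this
    refine ⟨e * i₀, mul_ne_zero he hi₀0, ?_⟩
    have : (expandHom K (e * i₀) (mul_ne_zero he hi₀0)) =
        (expandHom K e he).comp
          (expandHom K i₀ hi₀0) := by
      ext1 a
      exact PowerSeries.expand_mul e he i₀ hi₀0 a
    rw [this, ← Polynomial.map_map, hscale, map_scaleRoots _ _ _ (by rw [hhm]; simp)]
    exact hs.scaleRoots _
  -- split `h` by moving one of the roots of its reduction to the origin
  set hbar := h.map (PowerSeries.constantCoeff (R := K)) with hbar_def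
  have hbm : hbar.Monic := hhm.map _
  have hbd : hbar.natDegree = n + 1 := by rw [hbar_def, hhm.natDegree_map, hhd]
  obtain ⟨α, hα⟩ := IsAlgClosed.exists_root hbar (by
    rw [degree_eq_natDegree hbm.ne_zero, hbd]; exact_mod_cast Nat.succ_ne_zero n)
  set h' := taylor (PowerSeries.C α) h with hh'
  have hh'm : h'.Monic := by rw [hh', Monic, leadingCoeff_taylor]; exact hhm
  have hh'd : h'.natDegree = n + 1 := by rw [hh', natDegree_taylor, hhd]
  have hmap : h'.map (PowerSeries.constantCoeff (R := K)) = taylor α hbar := by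
    rw [hh', map_taylor]; simp [hbar_def]
  obtain ⟨u, v, hum, hvm, huv, hud, hvd⟩ :=
    exists_monic_mul_of_map_constantCoeff_ne hh'm
    (by
      rw [← Polynomial.coeff_map, hmap, taylor_coeff_zero]; exact hα)
    (by
      rw [hmap, hh'd]
      intro hcon
      have h1 := coeff_taylor_natDegree_sub_one hbm hbd α
      rw [hcon, hbar_def, Polynomial.coeff_map, hhc n (by omega), hbn, Polynomial.coeff_X_pow, if_neg (by omega)] at h1
      have h2 : α = 0 := by simpa [hn0] using h1.symm
      rw [h2, taylor_zero] at hcon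
      have h3 := congrArg (fun q ↦ q.coeff j₀) hcon
      simp only [hbar_def, Polynomial.coeff_map, hhc j₀ hj₀.1, Polynomial.coeff_X_pow, if_neg hj₀.1.ne] at h3
      exact hbj₀ h3)
  obtain ⟨e₁, he₁, hs₁⟩ := ih u.natDegree (hh'd ▸ hud) u hum rfl
  obtain ⟨e₂, he₂, hs₂⟩ := ih v.natDegree (hh'd ▸ hvd) v hvm rfl
  refine ⟨e₁ * e₂, mul_ne_zero he₁ he₂, ?_⟩
  have hE : (expandHom K (e₁ * e₂) (mul_ne_zero he₁ he₂)) =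
      (expandHom K e₁ he₁).comp
        (expandHom K e₂ he₂) := by
    ext1 a
    exact PowerSeries.expand_mul e₁ he₁ e₂ he₂ a
  have hE' : (expandHom K (e₁ * e₂) (mul_ne_zero he₁ he₂)) =
      (expandHom K e₂ he₂).comp
        (expandHom K e₁ he₁) := by
    ext1 a
    simp only [mul_comm e₁ e₂]
    exact PowerSeries.expand_mul e₂ he₂ e₁ he₁ a
  have hsplit : (h'.map (expandHom K (e₁ * e₂) (mul_ne_zero he₁ he₂))).Splits := by
    rw [huv, Polynomial.map_mul]
    refine Splits.mul ?_ ?_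
    · rw [hE', ← Polynomial.map_map]
      exact hs₁.map _
    · rw [hE, ← Polynomial.map_map]
      exact hs₂.map _
  have : h = taylor (-PowerSeries.C α) h' := by rw [hh', taylor_taylor]; simp
  rw [this, map_taylor]
  exact hsplit.taylor _

end Puiseux

section PlaneCurve

lemma derivative_aeval_fin_three {L : Type*} [CommRing L] (p : Fin 3 → Polynomial L)
    (F : MvPolynomial (Fin 3) L) :
    Polynomial.derivative (aeval p F) =
      ∑ i, aeval p (pderiv i F) * Polynomial.derivative (p i) := by
  induction F using MvPolynomial.induction_on with
  | C a => simp [MvPolynomial.algHom_C]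
  | add f g hf hg => simp [hf, hg, add_mul, Finset.sum_add_distrib]
  | mul_X f j hf =>
    have h : ∀ i, aeval p (pderiv i (f * X j)) * Polynomial.derivative (p i) =
        (aeval p (pderiv i f) * Polynomial.derivative (p i)) * p j +
          if i = j then aeval p f * Polynomial.derivative (p i) else 0 := by
      intro i
      rw [Derivation.leibniz, smul_eq_mul, smul_eq_mul, map_add, map_mul, map_mul, aeval_X]
      split_ifs with hij
      · rw [hij, pderiv_X_self, map_one]; ring
      · rw [pderiv_X_of_ne (Ne.symm hij), map_zero]; ring
    rw [Finset.sum_congr rfl fun i _ ↦ h i, Finset.sum_add_distrib, ← Finset.sum_mul, ← hf,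
      Finset.sum_ite_eq' Finset.univ j, if_pos (Finset.mem_univ _), map_mul, aeval_X,
      Polynomial.derivative_mul]

lemma aeval_fin_three_eq_sum {L A : Type*} [CommRing L] [CommRing A] [Algebra L A] (p : Fin 3 → A)
    (F : MvPolynomial (Fin 3) L) :
    aeval p F = ∑ e ∈ F.support, algebraMap L A (F.coeff e) *
      (p 0 ^ e 0 * p 1 ^ e 1 * p 2 ^ e 2) := by
  rw [aeval_def, eval₂_eq']
  simp [Fin.prod_univ_three]

lemma IsHomogeneous.add_eq_of_mem_support {L : Type*} [CommRing L] {F : MvPolynomial (Fin 3) L}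
    {d : ℕ} (hF : F.IsHomogeneous d) {e : Fin 3 →₀ ℕ} (he : e ∈ F.support) :
    e 0 + e 1 + e 2 = d := by
  have := hF (mem_support_iff.1 he)
  rw [Finsupp.weight_apply, Finsupp.sum_fintype _ _ (by simp)] at this
  simpa [Fin.sum_univ_three] using this

lemma IsHomogeneous.aeval_mul {L A : Type*} [CommRing L] [CommRing A] [Algebra L A]
    {F : MvPolynomial (Fin 3) L} {d : ℕ} (hF : F.IsHomogeneous d) (g : A) (p : Fin 3 → A) :
    aeval (fun i ↦ g * p i) F = g ^ d * aeval p F := by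
  rw [aeval_fin_three_eq_sum, aeval_fin_three_eq_sum, Finset.mul_sum]
  refine Finset.sum_congr rfl fun e he ↦ ?_
  rw [← IsHomogeneous.add_eq_of_mem_support hF he]
  ring

lemma IsHomogeneous.coeff_aeval {L : Type*} [CommRing L] {F : MvPolynomial (Fin 3) L} {d m : ℕ}
    (hF : F.IsHomogeneous d) {p : Fin 3 → Polynomial L} (hp : ∀ i, (p i).natDegree ≤ m) :
    (aeval p F).coeff (d * m) = eval (fun i ↦ (p i).coeff m) F := by
  rw [aeval_fin_three_eq_sum, ← coe_aeval_eq_eval, RingHom.coe_coe, aeval_fin_three_eq_sum,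
    Polynomial.finsetSum_coeff]
  refine Finset.sum_congr rfl fun e he ↦ ?_
  have h : ∀ i, (p i ^ e i).natDegree ≤ e i * m := fun i ↦
    Polynomial.natDegree_pow_le_of_le _ (hp i)
  rw [← IsHomogeneous.add_eq_of_mem_support hF he, Polynomial.algebraMap_eq,
    Polynomial.coeff_C_mul, add_mul, add_mul, Polynomial.coeff_mul_add_eq_of_natDegree_le
      (Polynomial.natDegree_mul_le_of_le (h 0) (h 1)) (h 2),
    Polynomial.coeff_mul_add_eq_of_natDegree_le (h 0) (h 1),
    Polynomial.coeff_pow_of_natDegree_le (hp 0), Polynomial.coeff_pow_of_natDegree_le (hp 1),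
    Polynomial.coeff_pow_of_natDegree_le (hp 2)]
  rfl

lemma eval_aeval_fin_three {L : Type*} [CommRing L] (p : Fin 3 → Polynomial L) (x : L)
    (F : MvPolynomial (Fin 3) L) :
    (aeval p F).eval x = eval (fun i ↦ (p i).eval x) F := by
  rw [aeval_fin_three_eq_sum, ← coe_aeval_eq_eval, RingHom.coe_coe, aeval_fin_three_eq_sum,
    Polynomial.eval_finsetSum]
  simp

/-- A morphism from the affine line to a smooth plane curve of positive genus is constant, for
coordinates without common zeros. -/
lemma mul_derivative_eq_of_no_common_root {L : Type*} [Field L] [IsAlgClosed L] [CharZero L]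
    {d : ℕ} (hd : 3 ≤ d) {F : MvPolynomial (Fin 3) L} (hF : F.IsHomogeneous d)
    (hs : ∀ P : Fin 3 → L, P ≠ 0 → ∃ i, eval P (pderiv i F) ≠ 0)
    {p : Fin 3 → Polynomial L} (hp : aeval p F = 0)
    (hcop : ∀ x, ∃ i, (p i).eval x ≠ 0) (i j : Fin 3) :
    p i * Polynomial.derivative (p j) = p j * Polynomial.derivative (p i) := by
  set f : Fin 3 → Polynomial L := fun i ↦ aeval p (pderiv i F) with hf
  have hE : f 0 * p 0 + f 1 * p 1 + f 2 * p 2 = 0 := by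
    have h := congrArg (aeval p) hF.sum_X_mul_pderiv
    simp only [Fin.sum_univ_three, map_add, map_mul, aeval_X, map_nsmul, hp, nsmul_zero] at h
    linear_combination h
  have hD : f 0 * Polynomial.derivative (p 0) + f 1 * Polynomial.derivative (p 1) +
      f 2 * Polynomial.derivative (p 2) = 0 := by
    have h := derivative_aeval_fin_three p F
    rw [hp, map_zero, Fin.sum_univ_three] at h
    exact h.symm
  have heval : ∀ x i, (f i).eval x = eval (fun i ↦ (p i).eval x) (pderiv i F) := by
    exact fun x i ↦ eval_aeval_fin_three p x _
  have hB : ∃ α : Fin 3 → Polynomial L, α 0 * f 0 + α 1 * f 1 + α 2 * f 2 = 1 := by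
    have htop : Ideal.span {f 0, f 1, f 2} = ⊤ := by
      obtain ⟨g, hg⟩ := IsPrincipalIdealRing.principal (Ideal.span {f 0, f 1, f 2})
      rw [Ideal.submodule_span_eq] at hg
      by_contra hcon
      have hgu : ¬ IsUnit g := by rwa [hg, Ideal.span_singleton_eq_top] at hcon
      obtain ⟨x, hx⟩ := IsAlgClosed.exists_root g (by
        rw [Polynomial.isUnit_iff_degree_eq_zero] at hgu; exact hgu)
      obtain ⟨i₁, hi₁⟩ := hcop x
      obtain ⟨r, hr⟩ := hs (fun i ↦ (p i).eval x) fun h ↦ hi₁ (congrFun h i₁)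
      have hmem : f r ∈ Ideal.span {f 0, f 1, f 2} :=
        Ideal.subset_span (by fin_cases r <;> simp)
      rw [hg, Ideal.mem_span_singleton] at hmem
      obtain ⟨q, hq⟩ := hmem
      rw [← heval, hq, Polynomial.eval_mul, hx, zero_mul] at hr
      exact hr rfl
    have h1 : (1 : Polynomial L) ∈ Ideal.span {f 0, f 1, f 2} := htop ▸ Submodule.mem_top
    rw [Ideal.mem_span_insert] at h1
    obtain ⟨a, z, hz, h1⟩ := h1
    obtain ⟨b, e, he⟩ := Ideal.mem_span_pair.1 hz
    exact ⟨![a, b, e], by simp [h1, ← he, add_assoc]⟩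
  obtain ⟨α, hα⟩ := hB
  set c : Fin 3 → Fin 3 → Polynomial L := fun i j ↦
    p i * Polynomial.derivative (p j) - p j * Polynomial.derivative (p i) with hc
  obtain ⟨m, hm, i₀, hi₀⟩ : ∃ m, (∀ i, (p i).natDegree ≤ m) ∧ ∃ i, (p i).natDegree = m := by
    obtain ⟨i₀, -, h⟩ := Finset.exists_max_image Finset.univ (fun i ↦ (p i).natDegree)
      ⟨0, Finset.mem_univ _⟩
    exact ⟨_, fun i ↦ h i (Finset.mem_univ _), i₀, rfl⟩
  suffices c i j = 0 from sub_eq_zero.1 this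
  rcases Nat.eq_zero_or_pos m with rfl | hm0
  · have h : ∀ i, Polynomial.derivative (p i) = 0 := fun i ↦
      Polynomial.derivative_of_natDegree_zero (Nat.le_zero.1 (hm i))
    simp [hc, h]
  have hcd : ∀ i j, (c i j).natDegree < 2 * m := by
    intro i j
    have h : ∀ i j, (p i * Polynomial.derivative (p j)).natDegree < 2 * m := fun i j ↦ by
      have h1 := Polynomial.natDegree_mul_le (p := p i) (q := Polynomial.derivative (p j))
      have h2 := Polynomial.natDegree_derivative_le (p j)
      have h3 := hm i
      have h4 := hm j
      omega
    exact (Polynomial.natDegree_sub_le _ _).trans_lt (max_lt (h i j) (h j i))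
  set lam := α 0 * c 1 2 + α 1 * c 2 0 + α 2 * c 0 1 with hlam
  have h01 : f 0 * c 2 0 = f 1 * c 1 2 := by
    simp only [hc]
    linear_combination p 2 * hD - Polynomial.derivative (p 2) * hE
  have h02 : f 0 * c 0 1 = f 2 * c 1 2 := by
    simp only [hc]
    linear_combination Polynomial.derivative (p 1) * hE - p 1 * hD
  have h12 : f 1 * c 0 1 = f 2 * c 2 0 := by
    simp only [hc]
    linear_combination p 0 * hD - Polynomial.derivative (p 0) * hE
  have h0 : c 1 2 = f 0 * lam := by
    linear_combination (-c 1 2) * hα - α 1 * h01 - α 2 * h02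
  have h1 : c 2 0 = f 1 * lam := by
    linear_combination (-c 2 0) * hα + α 0 * h01 - α 2 * h12
  have h2 : c 0 1 = f 2 * lam := by
    linear_combination (-c 0 1) * hα + α 0 * h02 + α 1 * h12
  have hl : lam = 0 := by
    by_contra hl
    obtain ⟨r, hr⟩ := hs (fun i ↦ (p i).coeff m) (by
      intro h
      have := congrFun h i₀
      simp only [← hi₀, Polynomial.coeff_natDegree, Pi.zero_apply,
        Polynomial.leadingCoeff_eq_zero] at this
      rw [this] at hi₀
      simp at hi₀
      omega)
    rw [← IsHomogeneous.coeff_aeval hF.pderiv hm] at hr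
    have hfr : (d - 1) * m ≤ (f r).natDegree := Polynomial.le_natDegree_of_ne_zero hr
    have hfl : (f r).natDegree ≤ (f r * lam).natDegree := by
      rw [Polynomial.natDegree_mul _ hl]
      · omega
      · rintro h
        exact hr (by rw [← hf] at *; simp [f] at h; simp [h])
    have h2m : 2 * m ≤ (d - 1) * m := Nat.mul_le_mul_right _ (by omega)
    have : (f r * lam).natDegree < 2 * m := by
      fin_cases r
      · exact h0 ▸ hcd 1 2
      · exact h1 ▸ hcd 2 0
      · exact h2 ▸ hcd 0 1
    omega
  have hanti : ∀ i j, c i j = - c j i := fun i j ↦ by simp [hc]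
  rw [hl, mul_zero] at h0 h1 h2
  have hself : ∀ i, c i i = 0 := fun i ↦ by simp [hc]
  fin_cases i <;> fin_cases j
  · exact hself 0
  · exact h2
  · exact (hanti 0 2).trans (by rw [h1, neg_zero])
  · exact (hanti 1 0).trans (by rw [h2, neg_zero])
  · exact hself 1
  · exact h0
  · exact h1
  · exact (hanti 2 1).trans (by rw [h0, neg_zero])
  · exact hself 2

/-- A morphism from the affine line to a smooth plane curve of positive genus is constant. -/
theorem mul_derivative_eq_of_aeval_eq_zero {L : Type*} [Field L] [IsAlgClosed L] [CharZero L]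
    {d : ℕ} (hd : 3 ≤ d) {F : MvPolynomial (Fin 3) L} (hF : F.IsHomogeneous d)
    (hs : ∀ P : Fin 3 → L, P ≠ 0 → ∃ i, eval P (pderiv i F) ≠ 0)
    {p : Fin 3 → Polynomial L} (hp : aeval p F = 0) (i j : Fin 3) :
    p i * Polynomial.derivative (p j) = p j * Polynomial.derivative (p i) := by
  classical
  obtain ⟨_⟩ := (inferInstance : Nonempty (NormalizedGCDMonoid (Polynomial L)))
  obtain ⟨q, hq, hq1⟩ := Finset.univ.extract_gcd p ⟨0, Finset.mem_univ _⟩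
  set g := Finset.univ.gcd p with hg
  have hpq : p = fun i ↦ g * q i := funext fun i ↦ hq i (Finset.mem_univ _)
  by_cases hg0 : g = 0
  · rw [hpq]; simp [hg0]
  have hq0 : aeval q F = 0 := by
    rw [hpq, IsHomogeneous.aeval_mul hF] at hp
    exact (mul_eq_zero.1 hp).resolve_left (pow_ne_zero _ hg0)
  have h := mul_derivative_eq_of_no_common_root hd hF hs hq0 (fun x ↦ by
    by_contra! hcon
    have h1 : Polynomial.X - Polynomial.C x ∣ Finset.univ.gcd q :=
      Finset.dvd_gcd fun i _ ↦ Polynomial.dvd_iff_isRoot.2 (hcon i)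
    rw [hq1] at h1
    exact Polynomial.not_isUnit_X_sub_C x (isUnit_of_dvd_one h1)) i j
  rw [hpq]
  simp only [Polynomial.derivative_mul]
  linear_combination g ^ 2 * h

end PlaneCurve

section SmoothPlaneCurve

lemma IsSmoothPlaneCurve.mul_derivative_eq {k : Type} [Field k] [CharZero k] {d : ℕ} (hd : 3 ≤ d)
    {F : MvPolynomial (Fin 3) k} (hF : IsSmoothPlaneCurve d F) {p : Fin 3 → Polynomial k}
    (hp : aeval p F = 0) (i j : Fin 3) :
    p i * Polynomial.derivative (p j) = p j * Polynomial.derivative (p i) := by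
  set φ := algebraMap k (AlgebraicClosure k)
  have : CharZero (AlgebraicClosure k) := charZero_of_injective_algebraMap φ.injective
  have hp' : aeval (fun i ↦ (p i).map φ) (map φ F) = 0 := by
    have h := congrArg (Polynomial.map φ) hp
    rw [aeval_fin_three_eq_sum, Polynomial.map_zero, Polynomial.map_sum] at h
    rw [← h, aeval_def, eval₂_map, eval₂_eq']
    refine Finset.sum_congr rfl fun e _ ↦ ?_
    simp [Fin.prod_univ_three]
  have h := mul_derivative_eq_of_aeval_eq_zero hd (hF.1.map φ) (fun P hP ↦ by
    obtain ⟨i, hi⟩ := hF.2 P hP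
    exact ⟨i, by rwa [pderiv_map]⟩) hp' i j
  rw [Polynomial.derivative_map, Polynomial.derivative_map, ← Polynomial.map_mul,
    ← Polynomial.map_mul] at h
  exact Polynomial.map_injective φ φ.injective h

end SmoothPlaneCurve

section Places

lemma Padic.inv_abs_le_norm_intCast {p : ℕ} [Fact p.Prime] {n : ℤ} (hn : n ≠ 0) :
    (|(n : ℝ)|)⁻¹ ≤ ‖(n : ℚ_[p])‖ := by
  have hn' : (n : ℚ_[p]) ≠ 0 := Int.cast_ne_zero.2 hn
  have hp : (1 : ℝ) < p := by exact_mod_cast (Fact.out : p.Prime).one_lt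
  have h := Padic.norm_eq_zpow_neg_valuation hn'
  have h1 := Padic.norm_int_le_one (p := p) n
  have hv : 0 ≤ (n : ℚ_[p]).valuation := by
    by_contra! hcon
    rw [h] at h1
    exact absurd h1 (not_le.2 (one_lt_zpow₀ hp (by omega)))
  obtain ⟨v, hv⟩ := Int.eq_ofNat_of_zero_le hv
  rw [hv] at h
  have h2 := (Padic.norm_int_le_pow_iff_dvd n v).1 h.le
  rw [h, zpow_neg, zpow_natCast]
  refine inv_anti₀ (by positivity) ?_
  have h3 := Int.le_of_dvd (abs_pos.2 hn) ((dvd_abs _ _).2 h2)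
  exact_mod_cast h3

lemma norm_le_one_of_isIntegral {K : Type*} [NormedField K] [IsUltrametricDist K] {x : K}
    (hx : IsIntegral ℤ x) : ‖x‖ ≤ 1 := by
  have h : ‖x‖₊ ≤ 1 := (Valuation.integer.integers (NormedField.valuation (K := K))).isIntegral_iff_v_le_one.1
    (hx.tower_top (A := NormedField.valuation.integer))
  exact_mod_cast h

variable {k : Type*} [Field k] [NumberField k]

lemma exists_intCast_eq_norm {w : k} (hw : w ≠ 0) (hint : IsIntegral ℤ w) :
    ∃ n : ℤ, n ≠ 0 ∧ Algebra.norm ℚ w = n := by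
  obtain ⟨n, hn⟩ := IsIntegrallyClosed.isIntegral_iff.1 (Algebra.isIntegral_norm ℚ hint)
  refine ⟨n, ?_, by simpa using hn.symm⟩
  rintro rfl
  rw [map_zero, eq_comm, Algebra.norm_eq_zero_iff] at hn
  exact hw hn

lemma norm_intCast_eq_prod {K : Type*} [NormedField K] [IsAlgClosed K] [CharZero K] {w : k} {n : ℤ}
    (hn : Algebra.norm ℚ w = n) : ‖(n : K)‖ = ∏ σ : k →ₐ[ℚ] K, ‖σ w‖ := by
  rw [← norm_prod, ← Algebra.norm_eq_prod_embeddings ℚ K, hn]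
  simp

lemma abs_le_pow_finrank {w : k} {n : ℤ} (hn : Algebra.norm ℚ w = n) {R : ℝ}
    (hR : ∀ σ : k →+* ℂ, ‖σ w‖ ≤ R) : |(n : ℝ)| ≤ R ^ Module.finrank ℚ k := by
  have h := norm_intCast_eq_prod (K := ℂ) hn
  rw [← Complex.norm_intCast, h, ← AlgHom.card ℚ k ℂ, ← Finset.card_univ]
  exact (Finset.prod_le_prod (fun _ _ ↦ norm_nonneg _) fun σ _ ↦ hR σ.toRingHom).trans_eq
    (Finset.prod_const R)

/-- Liouville's inequality at an archimedean place. -/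
lemma inv_pow_finrank_le_norm_complex (φ : k →+* ℂ) {w : k} (hw : w ≠ 0) (hint : IsIntegral ℤ w)
    {R : ℝ} (hR1 : 1 ≤ R) (hR : ∀ σ : k →+* ℂ, ‖σ w‖ ≤ R) :
    (R ^ Module.finrank ℚ k)⁻¹ ≤ ‖φ w‖ := by
  classical
  obtain ⟨n, hn0, hn⟩ := exists_intCast_eq_norm hw hint
  have h := norm_intCast_eq_prod (K := ℂ) hn
  have h1 : (1 : ℝ) ≤ ‖(n : ℂ)‖ := by
    rw [Complex.norm_intCast]
    exact_mod_cast Int.one_le_abs hn0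
  rw [h, ← Finset.mul_prod_erase _ _ (Finset.mem_univ φ.toRatAlgHom)] at h1
  have h2 : ∏ σ ∈ Finset.univ.erase φ.toRatAlgHom, ‖σ w‖ ≤ R ^ Module.finrank ℚ k := by
    refine (Finset.prod_le_prod (fun _ _ ↦ norm_nonneg _) fun σ _ ↦ hR σ.toRingHom).trans ?_
    rw [Finset.prod_const]
    refine pow_le_pow_right₀ hR1 ?_
    rw [← AlgHom.card ℚ k ℂ]
    exact Finset.card_le_univ _
  rw [inv_le_iff_one_le_mul₀ (by positivity)]
  exact h1.trans (mul_le_mul_of_nonneg_left h2 (norm_nonneg _))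

/-- Liouville's inequality at a `p`-adic place. -/
lemma inv_pow_finrank_le_norm_padic {p : ℕ} [Fact p.Prime] (φ : k →+* PadicAlgCl p) {w : k}
    (hw : w ≠ 0) (hint : IsIntegral ℤ w) {R : ℝ} (hR : ∀ σ : k →+* ℂ, ‖σ w‖ ≤ R) :
    (R ^ Module.finrank ℚ k)⁻¹ ≤ ‖φ w‖ := by
  classical
  obtain ⟨n, hn0, hn⟩ := exists_intCast_eq_norm hw hint
  have h := norm_intCast_eq_prod (K := PadicAlgCl p) hn
  rw [← Finset.mul_prod_erase _ _ (Finset.mem_univ φ.toRatAlgHom)] at h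
  have h1 : ∏ σ ∈ Finset.univ.erase φ.toRatAlgHom, ‖σ w‖ ≤ 1 :=
    Finset.prod_le_one (fun _ _ ↦ norm_nonneg _) fun σ _ ↦
      norm_le_one_of_isIntegral (hint.map σ)
  have h2 : ‖(n : PadicAlgCl p)‖ = ‖(n : ℚ_[p])‖ := by
    rw [← PadicAlgCl.norm_extends, map_intCast]
  calc (R ^ Module.finrank ℚ k)⁻¹ ≤ (|(n : ℝ)|)⁻¹ :=
        inv_anti₀ (abs_pos.2 (Int.cast_ne_zero.2 hn0)) (abs_le_pow_finrank hn hR)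
    _ ≤ ‖(n : ℚ_[p])‖ := Padic.inv_abs_le_norm_intCast hn0
    _ ≤ ‖φ w‖ := by
      rw [← h2, h]
      exact mul_le_of_le_one_right (norm_nonneg _) h1

lemma isIntegral_of_norm_le_one {u : k}
    (h : ∀ (p : ℕ) [Fact p.Prime] (φ : k →+* PadicAlgCl p), ‖φ u‖ ≤ 1) : IsIntegral ℤ u := by
  have hu : IsIntegral ℚ u := Algebra.IsIntegral.isIntegral u
  have hc : ∀ i (p : ℕ) [Fact p.Prime], ‖((minpoly ℚ u).coeff i : ℚ_[p])‖ ≤ 1 := by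
    intro i p _
    set S := (NormedField.valuation (K := PadicAlgCl p)).integer
    set f := (minpoly ℚ u).map (algebraMap ℚ (PadicAlgCl p)) with hf
    have hfl : f ∈ Polynomial.lifts S.subtype := by
      rw [(IsAlgClosed.splits f).eq_prod_roots_of_monic ((minpoly.monic hu).map _)]
      refine Subsemiring.multiset_prod_mem _ _ fun q hq ↦ ?_
      obtain ⟨a, ha, rfl⟩ := Multiset.mem_map.1 hq
      have ha' : a ∈ (minpoly ℚ u).rootSet (PadicAlgCl p) := by
        classical
        rw [Polynomial.rootSet_def, Finset.mem_coe, Multiset.mem_toFinset]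
        exact ha
      rw [← NumberField.Embeddings.range_eval_eq_rootSet_minpoly k] at ha'
      obtain ⟨φ, rfl⟩ := ha'
      have hS : φ u ∈ S := h p φ
      refine ⟨Polynomial.X - Polynomial.C ⟨φ u, hS⟩, by simp⟩
    rw [Polynomial.lifts_iff_coeff_lifts] at hfl
    obtain ⟨a, ha⟩ := hfl i
    have ha1 : ‖(a : PadicAlgCl p)‖ ≤ 1 := a.2
    rw [← PadicAlgCl.norm_extends, map_ratCast]
    rw [hf, Polynomial.coeff_map, eq_ratCast] at ha
    rw [← ha]
    exact ha1
  have hl : minpoly ℚ u ∈ Polynomial.lifts (Int.castRingHom ℚ) := by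
    rw [Polynomial.lifts_iff_coeff_lifts]
    intro i
    set q := (minpoly ℚ u).coeff i
    refine ⟨q.num, ?_⟩
    have hd : q.den = 1 := by
      by_contra hcon
      obtain ⟨p, hp, hpd⟩ := Nat.exists_prime_and_dvd hcon
      have := Fact.mk hp
      have h1 := Padic.norm_rat_le_one_iff_padicValuation_le_one p |>.1 (hc i p)
      rw [Rat.padicValuation_le_one_iff] at h1
      exact h1 hpd
    rw [eq_intCast]
    exact Rat.coe_int_num_of_den_eq_one hd
  obtain ⟨g, hg, -, hgm⟩ := Polynomial.lifts_and_natDegree_eq_and_monic hl (minpoly.monic hu)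
  refine ⟨g, hgm, ?_⟩
  have := minpoly.aeval ℚ u
  rw [← hg, Polynomial.aeval_def, Polynomial.eval₂_map] at this
  rwa [RingHom.ext_int (algebraMap ℤ k) ((algebraMap ℚ k).comp (Int.castRingHom ℚ))]

/-- A nonzero element of a number field which is not a root of unity is contracting at some place,
and at this place Liouville's inequality holds. -/
theorem exists_place_norm_lt_one {t : k} (ht : t ≠ 0) (hroot : ∀ n, 0 < n → t ^ n ≠ 1) :
    ∃ (K : Type) (_ : NormedField K) (_ : IsAlgClosed K) (_ : CharZero K) (φ : k →+* K),
      ‖φ t‖ < 1 ∧ ∃ h : ℕ, ∀ (w : k) (R : ℝ), w ≠ 0 → IsIntegral ℤ w → 1 ≤ R →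
        (∀ σ : k →+* ℂ, ‖σ w‖ ≤ R) → (R ^ h)⁻¹ ≤ ‖φ w‖ := by
  by_contra! hcon
  have hinv : ∀ {K : Type} [NormedField K] (φ : k →+* K), ¬ ‖φ t‖ < 1 → ‖φ t⁻¹‖ ≤ 1 := by
    intro K _ φ h
    rw [map_inv₀, norm_inv]
    exact inv_le_one_of_one_le₀ (not_lt.1 h)
  have hint : IsIntegral ℤ t⁻¹ := isIntegral_of_norm_le_one fun p _ φ ↦ hinv φ fun h ↦ by
    obtain ⟨w, R, h1, h2, h3, h4, h5⟩ := hcon (PadicAlgCl p) inferInstance inferInstance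
      inferInstance φ h (Module.finrank ℚ k)
    exact absurd h5 (not_lt.2 (inv_pow_finrank_le_norm_padic φ h1 h2 h4))
  obtain ⟨n, hn, h⟩ := NumberField.Embeddings.pow_eq_one_of_norm_le_one k ℂ (inv_ne_zero ht) hint
    fun φ ↦ hinv φ fun h ↦ by
      obtain ⟨w, R, h1, h2, h3, h4, h5⟩ := hcon ℂ inferInstance inferInstance
        inferInstance φ h (Module.finrank ℚ k)
      exact absurd h5 (not_lt.2 (inv_pow_finrank_le_norm_complex φ h1 h2 h3 h4))
  exact hroot n hn (by simpa using h)

end Places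

section Growth

variable {k : Type*} [Field k]

/-- The terms `s m` have size at most `B * R ^ m` at all complex places, and denominators dividing
`b * c ^ m`. -/
def HasGrowth (c : ℕ) (R : ℝ) (s : ℕ → k) : Prop :=
  ∃ b : ℕ, b ≠ 0 ∧ ∃ B : ℝ, 1 ≤ B ∧
    ∀ m, IsIntegral ℤ ((b * c ^ m : k) * s m) ∧ ∀ σ : k →+* ℂ, ‖σ (s m)‖ ≤ B * R ^ m

namespace HasGrowth

variable {c c' : ℕ} {R R' : ℝ} {s s' : ℕ → k}

lemma add (h : HasGrowth c R s) (h' : HasGrowth c R s') :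
    HasGrowth c R (fun m ↦ s m + s' m) := by
  obtain ⟨b, hb, B, hB, h⟩ := h
  obtain ⟨b', hb', B', hB', h'⟩ := h'
  refine ⟨b * b', mul_ne_zero hb hb', B + B', by linarith, fun m ↦ ⟨?_, fun σ ↦ ?_⟩⟩
  · have := ((isIntegral_natCast b').mul (h m).1).add ((isIntegral_natCast b).mul (h' m).1)
    exact (congrArg (IsIntegral ℤ) (by push_cast; ring)).mp (this)
  · rw [map_add, add_mul]
    exact (norm_add_le _ _).trans (add_le_add ((h m).2 σ) ((h' m).2 σ))

lemma mul (h : HasGrowth c R s) (h' : HasGrowth c' R' s') :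
    HasGrowth (c * c') (R * R') (fun m ↦ s m * s' m) := by
  obtain ⟨b, hb, B, hB, h⟩ := h
  obtain ⟨b', hb', B', hB', h'⟩ := h'
  refine ⟨b * b', mul_ne_zero hb hb', B * B', one_le_mul_of_one_le_of_one_le hB hB',
    fun m ↦ ⟨?_, fun σ ↦ ?_⟩⟩
  · exact (congrArg (IsIntegral ℤ) (by push_cast; ring)).mp ((h m).1.mul (h' m).1)
  · rw [map_mul, norm_mul, mul_pow, mul_mul_mul_comm]
    exact mul_le_mul ((h m).2 σ) ((h' m).2 σ) (norm_nonneg _) ((norm_nonneg _).trans ((h m).2 σ))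

lemma mono (h : HasGrowth c R s) (hc : c ∣ c') (hR : 0 ≤ R) (hRR' : R ≤ R') :
    HasGrowth c' R' s := by
  obtain ⟨b, hb, B, hB, h⟩ := h
  obtain ⟨u, rfl⟩ := hc
  refine ⟨b, hb, B, hB, fun m ↦ ⟨?_, fun σ ↦ ((h m).2 σ).trans ?_⟩⟩
  · exact (congrArg (IsIntegral ℤ) (by push_cast; ring)).mp (((isIntegral_natCast u).pow m).mul (h m).1)
  · gcongr

lemma shift (hc : c ≠ 0) (hR : 1 ≤ R) (h : HasGrowth c R s) (a : ℕ) :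
    HasGrowth c R (fun m ↦ s (m + a)) := by
  obtain ⟨b, hb, B, hB, h⟩ := h
  refine ⟨b * c ^ a, mul_ne_zero hb (pow_ne_zero _ hc), B * R ^ a,
    one_le_mul_of_one_le_of_one_le hB (one_le_pow₀ hR), fun m ↦ ⟨?_, fun σ ↦ ?_⟩⟩
  · exact (congrArg (IsIntegral ℤ) (by push_cast; ring)).mp ((h (m + a)).1)
  · exact ((h (m + a)).2 σ).trans_eq (by ring)

lemma exists_common_bound {ι : Type*} (S : Finset ι) {s : ι → ℕ → k} (hR : 0 ≤ R)
    (h : ∀ i ∈ S, HasGrowth c R (s i)) :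
    ∃ b : ℕ, b ≠ 0 ∧ ∃ B : ℝ, 1 ≤ B ∧ ∀ i ∈ S, ∀ m,
      IsIntegral ℤ ((b * c ^ m : k) * s i m) ∧ ∀ σ : k →+* ℂ, ‖σ (s i m)‖ ≤ B * R ^ m := by
  classical
  induction S using Finset.induction_on with
  | empty => exact ⟨1, one_ne_zero, 1, le_rfl, by simp⟩
  | insert i S _ ih =>
    obtain ⟨b, hb, B, hB, h1⟩ := ih fun j hj ↦ h j (Finset.mem_insert_of_mem hj)
    obtain ⟨b', hb', B', hB', h2⟩ := h i (Finset.mem_insert_self _ _)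
    refine ⟨b * b', mul_ne_zero hb hb', max B B', hB.trans (le_max_left _ _), fun j hj m ↦ ?_⟩
    rcases Finset.mem_insert.1 hj with rfl | hj
    · refine ⟨?_, fun σ ↦ ((h2 m).2 σ).trans ?_⟩
      · exact (congrArg (IsIntegral ℤ) (by push_cast; ring)).mp ((isIntegral_natCast b).mul (h2 m).1)
      · gcongr
        exact le_max_right _ _
    · refine ⟨?_, fun σ ↦ ((h1 j hj m).2 σ).trans ?_⟩
      · exact (congrArg (IsIntegral ℤ) (by push_cast; ring)).mp ((isIntegral_natCast b').mul (h1 j hj m).1)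
      · gcongr
        exact le_max_left _ _

lemma zero (hR : 0 ≤ R) : HasGrowth c R (fun _ ↦ (0 : k)) := by
  refine ⟨1, one_ne_zero, 1, le_rfl, fun m ↦ ⟨by simpa using isIntegral_zero, fun σ ↦ ?_⟩⟩
  simp only [map_zero, norm_zero]
  positivity

lemma sum {ι : Type*} (S : Finset ι) {s : ι → ℕ → k} (hR : 0 ≤ R)
    (h : ∀ i ∈ S, HasGrowth c R (s i)) : HasGrowth c R (fun m ↦ ∑ i ∈ S, s i m) := by
  classical
  induction S using Finset.induction_on with
  | empty => simpa using zero hR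
  | insert i S hi ih =>
    simp only [Finset.sum_insert hi]
    exact (h i (Finset.mem_insert_self _ _)).add
      (ih fun j hj ↦ h j (Finset.mem_insert_of_mem hj))

/-- A norm bound on the coefficients of a monic polynomial bounds its roots. -/
lemma _root_.Polynomial.Monic.norm_root_le {K : Type*} [NormedField K] {p : Polynomial K}
    (hp : p.Monic) {M : ℝ} (hM : 0 ≤ M) (hcoeff : ∀ i < p.natDegree, ‖p.coeff i‖ ≤ M) {y : K}
    (hy : p.eval y = 0) : ‖y‖ ≤ M + 1 := by
  have h := Polynomial.IsRoot.norm_lt_cauchyBound hp.ne_zero hy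
  lift M to NNReal using hM
  suffices p.cauchyBound ≤ M + 1 by exact_mod_cast h.le.trans this
  rw [Polynomial.cauchyBound, hp.leadingCoeff, nnnorm_one, div_one]
  gcongr
  exact Finset.sup_le fun i hi ↦ hcoeff i (Finset.mem_range.1 hi)

lemma root (hR : 1 ≤ R) {p : ℕ → Polynomial k} {D : ℕ} (hp : ∀ m, (p m).Monic)
    (hD : ∀ m, (p m).natDegree = D) (hcoeff : ∀ j < D, HasGrowth c R fun m ↦ (p m).coeff j)
    (hs : ∀ m, (p m).eval (s m) = 0) : HasGrowth c R s := by
  have hD0 : D ≠ 0 := by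
    rintro rfl
    simpa [Polynomial.eq_one_of_monic_natDegree_zero (hp 0) (hD 0)] using hs 0
  obtain ⟨b, hb, B, hB, h⟩ := exists_common_bound (Finset.range D) (by linarith)
    fun j hj ↦ hcoeff j (Finset.mem_range.1 hj)
  refine ⟨b, hb, B + 1, by linarith, fun m ↦ ⟨?_, fun σ ↦ ?_⟩⟩
  · set β : k := b * c ^ m with hβ
    have hβi : IsIntegral ℤ β := (isIntegral_natCast b).mul ((isIntegral_natCast c).pow m)
    have hmon : ((p m).scaleRoots β).Monic := (Polynomial.monic_scaleRoots_iff β).2 (hp m)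
    refine IsIntegral.of_aeval_monic_of_isIntegral_coeff hmon ?_ ?_ fun i ↦ ?_
    · rwa [Polynomial.natDegree_scaleRoots, hD]
    · rw [Polynomial.scaleRoots_eval_mul, hs, mul_zero]
      exact isIntegral_zero
    · rw [Polynomial.coeff_scaleRoots, hD]
      rcases lt_trichotomy i D with hi | rfl | hi
      · obtain ⟨j, hj⟩ : ∃ j, D - i = j + 1 := ⟨D - i - 1, by omega⟩
        rw [hj]
        exact (congrArg (IsIntegral ℤ) (by rw [hβ]; ring)).mp
          ((h i (Finset.mem_range.2 hi) m).1.mul (hβi.pow j))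
      · have := (hp m).coeff_natDegree
        rw [hD] at this
        simpa [this] using isIntegral_one
      · rw [Polynomial.coeff_eq_zero_of_natDegree_lt (by rwa [hD]), zero_mul]
        exact isIntegral_zero
  · have hRm := one_le_pow₀ hR (n := m)
    have := ((hp m).map σ).norm_root_le (M := B * R ^ m) (by positivity) (fun i hi ↦ by
      rw [(hp m).natDegree_map, hD] at hi
      rw [Polynomial.coeff_map]
      exact (h i (Finset.mem_range.2 hi) m).2 σ) (y := σ (s m)) (by
        rw [Polynomial.eval_map, Polynomial.eval₂_hom, hs, map_zero])
    exact this.trans (by linarith)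

variable [NumberField k]

lemma exists_natCast_mul_isIntegral (a : k) : ∃ b : ℕ, b ≠ 0 ∧ IsIntegral ℤ ((b : k) * a) := by
  obtain ⟨n, hn, h⟩ := ((IsFractionRing.isAlgebraic_iff ℤ ℚ k).2 (Algebra.IsAlgebraic.isAlgebraic a)).exists_integral_multiple
  refine ⟨n.natAbs, Int.natAbs_ne_zero.2 hn, ?_⟩
  rw [zsmul_eq_mul] at h
  rw [Nat.cast_natAbs]
  rcases abs_choice n with hn | hn <;> rw [hn]
  · exact h
  · simpa using h.neg

lemma exists_norm_le (a : k) : ∃ B : ℝ, 1 ≤ B ∧ ∀ σ : k →+* ℂ, ‖σ a‖ ≤ B :=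
  ⟨1 + ∑ σ : k →+* ℂ, ‖σ a‖, by
    have : 0 ≤ ∑ σ : k →+* ℂ, ‖σ a‖ := Finset.sum_nonneg fun _ _ ↦ norm_nonneg _
    linarith, fun σ ↦ by
    have := Finset.single_le_sum (f := fun σ : k →+* ℂ ↦ ‖σ a‖) (fun _ _ ↦ norm_nonneg _)
      (Finset.mem_univ σ)
    linarith⟩

lemma const (a : k) : HasGrowth 1 1 (fun _ ↦ a) := by
  obtain ⟨b, hb, h⟩ := exists_natCast_mul_isIntegral a
  obtain ⟨B, hB, h'⟩ := exists_norm_le a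
  exact ⟨b, hb, B, hB, fun m ↦ ⟨by simpa using h, fun σ ↦ by simpa using h' σ⟩⟩

lemma const_mul (a : k) (h : HasGrowth c R s) : HasGrowth c R (fun m ↦ a * s m) := by
  simpa using (const a).mul h

/-- The values `A (t ^ m)` of polynomials `A` of bounded degree have uniformly bounded growth. -/
lemma exists_eval_pow (t : k) (E : ℕ) : ∃ c : ℕ, c ≠ 0 ∧ ∃ R : ℝ, 1 ≤ R ∧
    ∀ A : Polynomial k, A.natDegree ≤ E → HasGrowth c R fun m ↦ A.eval (t ^ m) := by
  obtain ⟨v, hv, hvt⟩ := exists_natCast_mul_isIntegral t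
  obtain ⟨R, hR, hRt⟩ := exists_norm_le t
  refine ⟨v ^ E, pow_ne_zero _ hv, R ^ E, one_le_pow₀ hR, fun A hA ↦ ?_⟩
  have hR0 : 0 ≤ R := by linarith
  have hpow : ∀ i ≤ E, HasGrowth (v ^ E) (R ^ E) fun m ↦ (t ^ m) ^ i := by
    intro i hi
    have : HasGrowth (v ^ i) (R ^ i) fun m ↦ (t ^ m) ^ i := by
      refine ⟨1, one_ne_zero, 1, le_rfl, fun m ↦ ⟨?_, fun σ ↦ ?_⟩⟩
      · exact (congrArg (IsIntegral ℤ) (by push_cast; ring)).mp ((hvt.pow m).pow i)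
      · rw [one_mul, pow_right_comm, map_pow, map_pow, norm_pow, norm_pow]
        gcongr
        exact hRt σ
    exact this.mono (pow_dvd_pow v hi) (by positivity) (pow_le_pow_right₀ hR hi)
  simp only [Polynomial.eval_eq_sum_range]
  exact sum _ (by positivity) fun i hi ↦
    (hpow i ((Nat.lt_succ_iff.1 (Finset.mem_range.1 hi)).trans hA)).const_mul _

/-- Liouville's inequality for the terms of a sequence. -/
lemma exists_le_norm {K : Type*} [NormedField K] (φ : k →+* K) {h : ℕ}
    (hφ : ∀ (w : k) (R : ℝ), w ≠ 0 → IsIntegral ℤ w → 1 ≤ R → (∀ σ : k →+* ℂ, ‖σ w‖ ≤ R) →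
      (R ^ h)⁻¹ ≤ ‖φ w‖) (hc : c ≠ 0) (hR : 1 ≤ R) :
    ∃ r : ℝ, 0 < r ∧ ∀ s : ℕ → k, HasGrowth c R s → ∃ κ : ℝ, 0 < κ ∧
      ∀ m, s m ≠ 0 → κ * r ^ m ≤ ‖φ (s m)‖ := by
  have hc1 : (1 : ℝ) ≤ c := by exact_mod_cast Nat.one_le_iff_ne_zero.2 hc
  have hR0 : 0 < R := by linarith
  refine ⟨((c * R) ^ h * c)⁻¹, by positivity, fun s ⟨b, hb, B, hB, hs⟩ ↦ ?_⟩
  have hb1 : (1 : ℝ) ≤ b := by exact_mod_cast Nat.one_le_iff_ne_zero.2 hb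
  have hB0 : 0 < B := by linarith
  refine ⟨((b * B) ^ h * b)⁻¹, by positivity, fun m hm ↦ ?_⟩
  have hw0 : (b * c ^ m : k) ≠ 0 := by
    have : ((b * c ^ m : ℕ) : k) ≠ 0 := Nat.cast_ne_zero.2 (mul_ne_zero hb (pow_ne_zero _ hc))
    exact_mod_cast this
  have key := hφ ((b * c ^ m : k) * s m) (b * c ^ m * (B * R ^ m)) (mul_ne_zero hw0 hm) (hs m).1
    (one_le_mul_of_one_le_of_one_le (one_le_mul_of_one_le_of_one_le hb1 (one_le_pow₀ hc1))
      (one_le_mul_of_one_le_of_one_le hB (one_le_pow₀ hR))) fun σ ↦ by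
    rw [map_mul, norm_mul]
    simp only [map_mul, map_pow, map_natCast, norm_mul, norm_pow, Complex.norm_natCast]
    gcongr
    exact (hs m).2 σ
  have hle : ‖φ ((b * c ^ m : k) * s m)‖ ≤ b * c ^ m * ‖φ (s m)‖ := by
    rw [map_mul, norm_mul]
    simp only [map_mul, map_pow, map_natCast, norm_mul, norm_pow]
    gcongr <;> exact (Nat.norm_cast_le _).trans_eq (by simp)
  have h1 := key.trans hle
  rw [inv_pow, ← mul_inv, inv_le_iff_one_le_mul₀ (by positivity)]
  rw [inv_le_iff_one_le_mul₀ (by positivity)] at h1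
  refine h1.trans_eq ?_
  ring

end HasGrowth

end Growth

section Approximation

variable {K : Type*} [NormedField K]

lemma Polynomial.exists_norm_eval_le (A : Polynomial K) (M : ℝ) :
    ∃ B : ℝ, 0 ≤ B ∧ ∀ x : K, ‖x‖ ≤ M → ‖A.eval x‖ ≤ B := by
  refine ⟨∑ i ∈ Finset.range (A.natDegree + 1), ‖A.coeff i‖ * |M| ^ i, by positivity,
    fun x hx ↦ ?_⟩
  rw [Polynomial.eval_eq_sum_range]
  refine (norm_sum_le _ _).trans (Finset.sum_le_sum fun i _ ↦ ?_)
  rw [norm_mul, norm_pow]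
  gcongr
  exact hx.trans (le_abs_self M)

lemma Polynomial.exists_norm_evalEval_le (A : Polynomial (Polynomial K)) (M : ℝ) :
    ∃ B : ℝ, 0 ≤ B ∧ ∀ x y : K, ‖x‖ ≤ M → ‖y‖ ≤ M → ‖A.evalEval x y‖ ≤ B := by
  choose B hB hB' using fun i ↦ (A.coeff i).exists_norm_eval_le M
  refine ⟨∑ i ∈ Finset.range (A.natDegree + 1), B i * |M| ^ i,
    Finset.sum_nonneg fun i _ ↦ mul_nonneg (hB i) (by positivity), fun x y hx hy ↦ ?_⟩
  rw [Polynomial.evalEval, Polynomial.eval_eq_sum_range (p := A), Polynomial.eval_finsetSum]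
  refine (norm_sum_le _ _).trans (Finset.sum_le_sum fun i _ ↦ ?_)
  rw [Polynomial.eval_mul, Polynomial.eval_pow, Polynomial.eval_C, norm_mul, norm_pow]
  have := hB i
  gcongr
  · exact hB' i x hx
  · exact hy.trans (le_abs_self M)

lemma Polynomial.Monic.exists_norm_le_of_evalEval_eq_zero {A : Polynomial (Polynomial K)}
    (hA : A.Monic) (M : ℝ) :
    ∃ B : ℝ, 0 ≤ B ∧ ∀ x y : K, ‖x‖ ≤ M → A.evalEval x y = 0 → ‖y‖ ≤ B := by
  choose B hB hB' using fun i ↦ (A.coeff i).exists_norm_eval_le M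
  have hS : 0 ≤ ∑ i ∈ Finset.range A.natDegree, B i := Finset.sum_nonneg fun i _ ↦ hB i
  refine ⟨(∑ i ∈ Finset.range A.natDegree, B i) + 1, by linarith, fun x y hx hxy ↦ ?_⟩
  refine (hA.map (Polynomial.evalRingHom x)).norm_root_le hS (fun i hi ↦ ?_)
    (by rwa [Polynomial.map_evalRingHom_eval])
  rw [hA.natDegree_map] at hi
  rw [Polynomial.coeff_map, Polynomial.coe_evalRingHom]
  exact (hB' i x hx).trans
    (Finset.single_le_sum (fun i _ ↦ hB i) (Finset.mem_range.2 hi))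

/-- Truncating the roots of a polynomial with power series roots changes it by a multiple of
`X ^ N`. -/
lemma Polynomial.C_X_pow_dvd_prod_trunc_sub {K : Type*} [Field K] {A : Polynomial (Polynomial K)}
    {s : Multiset (PowerSeries K)}
    (hs : A.map Polynomial.coeToPowerSeries.ringHom =
      (s.map fun y ↦ Polynomial.X - Polynomial.C y).prod) (N : ℕ) :
    Polynomial.C (Polynomial.X ^ N) ∣
      (s.map fun y ↦ Polynomial.X - Polynomial.C (PowerSeries.trunc N y)).prod - A := by
  set ι : Polynomial K →+* PowerSeries K := Polynomial.coeToPowerSeries.ringHom with hι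
  set B := (s.map fun y ↦ Polynomial.X - Polynomial.C (PowerSeries.trunc N y)).prod with hB
  set I : Ideal (PowerSeries K) := Ideal.span {PowerSeries.X ^ N}
  have hmap : (B.map ι).map (Ideal.Quotient.mk I) = (A.map ι).map (Ideal.Quotient.mk I) := by
    rw [hs, hB]
    simp only [Polynomial.map_multiset_prod, Multiset.map_map, Function.comp_def,
      Polynomial.map_sub, Polynomial.map_X, Polynomial.map_C]
    congr 1
    refine Multiset.map_congr rfl fun y _ ↦ ?_
    congr 2
    rw [Ideal.Quotient.mk_eq_mk_iff_sub_mem, Ideal.mem_span_singleton, PowerSeries.X_pow_dvd_iff]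
    intro m hm
    simp [hι, PowerSeries.coeff_trunc, hm]
  rw [Polynomial.C_dvd_iff_dvd_coeff]
  intro i
  have hi := congrArg (fun p ↦ p.coeff i) hmap
  simp only [Polynomial.coeff_map] at hi
  rw [Ideal.Quotient.mk_eq_mk_iff_sub_mem, Ideal.mem_span_singleton, ← map_sub,
    PowerSeries.X_pow_dvd_iff] at hi
  rw [Polynomial.X_pow_dvd_iff]
  intro m hm
  simpa [hι] using hi m hm

lemma Multiset.exists_le_of_prod_le_pow {α : Type*} {s : Multiset α} {f : α → ℝ} {a : ℝ}
    (ha : 0 < a) (hs : s ≠ 0) (h : (s.map f).prod ≤ a ^ s.card) : ∃ x ∈ s, f x ≤ a := by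
  by_contra! hcon
  have key : ∀ s : Multiset α, (∀ x ∈ s, a < f x) → s ≠ 0 → a ^ s.card < (s.map f).prod := by
    intro s
    induction s using Multiset.induction_on with
    | empty => simp
    | cons x s ih =>
      intro hx _
      rw [Multiset.card_cons, Multiset.map_cons, Multiset.prod_cons, pow_succ']
      have h1 := hx x (Multiset.mem_cons_self x s)
      rcases eq_or_ne s 0 with rfl | hs
      · simpa using h1
      · have := ih (fun y hy ↦ hx y (Multiset.mem_cons_of_mem hy)) hs
        exact mul_lt_mul'' h1 this ha.le (by positivity)
  exact (key s hcon hs).not_ge h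

/-- Near `x = 0` the points of a plane curve are approximated by truncations of its branches. -/
lemma exists_finset_branch_approx {A : Polynomial (Polynomial K)} (hA : A.Monic)
    (hD : A.natDegree ≠ 0) (hs : (A.map Polynomial.coeToPowerSeries.ringHom).Splits) (J : ℕ) :
    ∃ S : Finset (Polynomial K), S.card ≤ A.natDegree ∧
      (∀ q ∈ S, q.degree < (A.natDegree * J : ℕ)) ∧
      ∃ B : ℝ, 0 ≤ B ∧ ∀ x y : K, x ≠ 0 → ‖x‖ ≤ 1 → A.evalEval x y = 0 →
        ∃ q ∈ S, ‖y - q.eval x‖ ≤ B * ‖x‖ ^ J := by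
  classical
  set D := A.natDegree with hDdef
  set s := (A.map Polynomial.coeToPowerSeries.ringHom).roots with hsdef
  have hmon := hA.map (Polynomial.coeToPowerSeries.ringHom (R := K))
  have hcard : s.card = D := by
    rw [hsdef, ← hs.natDegree_eq_card_roots, hA.natDegree_map]
  obtain ⟨T, hT⟩ :=
    Polynomial.C_X_pow_dvd_prod_trunc_sub (hs.eq_prod_roots_of_monic hmon) (D * J)
  obtain ⟨B, hB, hB'⟩ := hA.exists_norm_le_of_evalEval_eq_zero 1
  obtain ⟨B₁, hB₁, hB₁'⟩ := T.exists_norm_evalEval_le (max 1 B)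
  refine ⟨(s.map (PowerSeries.trunc (D * J))).toFinset, ?_, ?_, max 1 B₁,
    by positivity, fun x y hx0 hx hxy ↦ ?_⟩
  · exact (Multiset.toFinset_card_le _).trans (by rw [Multiset.card_map, hcard])
  · intro q hq
    obtain ⟨y, -, rfl⟩ := Multiset.mem_map.1 (Multiset.mem_toFinset.1 hq)
    exact PowerSeries.degree_trunc_lt y _
  · have h := congrArg (Polynomial.evalEval x y) hT
    rw [Polynomial.evalEval_sub, hxy, sub_zero, Polynomial.evalEval_mul, Polynomial.evalEval_C,
      Polynomial.eval_pow, Polynomial.eval_X, Polynomial.evalEval_multiset_prod,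
      Multiset.map_map] at h
    simp only [Function.comp_def, Polynomial.evalEval_sub, Polynomial.evalEval_X,
      Polynomial.evalEval_C] at h
    have hy := hB' x y hx hxy
    have hTxy := hB₁' x y (hx.trans (le_max_left _ _)) (hy.trans (le_max_right _ _))
    have hx' : 0 < ‖x‖ := norm_pos_iff.2 hx0
    have hprod : (s.map fun z ↦ ‖y - (PowerSeries.trunc (D * J) z).eval x‖).prod ≤
        (max 1 B₁ * ‖x‖ ^ J) ^ s.card := by
      rw [hcard, mul_pow, ← pow_mul, mul_comm J D]
      have h3 : (s.map fun z ↦ ‖y - (PowerSeries.trunc (D * J) z).eval x‖).prod =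
          ‖x ^ (D * J) * T.evalEval x y‖ := by
        have h4 := map_multiset_prod (normHom (α := K))
          (s.map fun z ↦ y - (PowerSeries.trunc (D * J) z).eval x)
        rw [Multiset.map_map] at h4
        rw [← h]
        exact h4.symm
      rw [h3, norm_mul, norm_pow, mul_comm]
      gcongr
      exact hTxy.trans ((le_max_right 1 B₁).trans (le_self_pow₀ (le_max_left _ _) hD))
    obtain ⟨z, hz, hz'⟩ := Multiset.exists_le_of_prod_le_pow
      (by positivity) (by rintro h0; simp [h0] at hcard; exact hD hcard.symm) hprod
    exact ⟨_, Multiset.mem_toFinset.2 (Multiset.mem_map_of_mem _ hz), hz'⟩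

end Approximation

section Interpolation

variable {k : Type*} [Field k] {K : Type*} [NormedField K]

lemma sum_basis_mul_eval {ι : Type*} [DecidableEq ι] {s : Finset ι} {v : ι → k}
    (hv : Set.InjOn v s) (φ : k →+* K) (x : k) (ξ : K) {q : Polynomial K}
    (hq : q.degree < s.card) :
    q.eval (ξ * φ x) =
      ∑ a ∈ s, φ ((Lagrange.basis s v a).eval x) * q.eval (ξ * φ (v a)) := by
  have hmon : ∀ i < s.card, x ^ i = ∑ a ∈ s, (Lagrange.basis s v a).eval x * v a ^ i := by
    intro i hi
    have h := Lagrange.eq_interpolate (f := (Polynomial.X ^ i : Polynomial k)) hv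
      (by rw [Polynomial.degree_X_pow]; exact_mod_cast hi)
    have h1 := congrArg (Polynomial.eval x) h
    simpa [Lagrange.interpolate_apply, Polynomial.eval_finsetSum, mul_comm] using h1
  rcases eq_or_ne q 0 with rfl | hq0
  · simp
  have hn := (Polynomial.natDegree_lt_iff_degree_lt hq0).2 hq
  simp only [Polynomial.eval_eq_sum_range' hn, Finset.mul_sum]
  rw [Finset.sum_comm]
  refine Finset.sum_congr rfl fun i hi ↦ ?_
  rw [mul_pow, ← map_pow, hmon i (Finset.mem_range.1 hi), map_sum, Finset.mul_sum, Finset.mul_sum]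
  refine Finset.sum_congr rfl fun a _ ↦ ?_
  rw [map_mul, map_pow]
  ring

/-- If the values `Y (m + a)`, `a ∈ A`, and `Y (m + b)` are all very well approximated by one
polynomial of degree less than `#A`, then `Y (m + b)` is obtained from the other ones by Lagrange
interpolation, provided that `m` is large enough. -/
lemma eventually_eq_eval_interpolate [NumberField k] {φ : k →+* K} {t : k}
    (hinj : Function.Injective fun n : ℕ ↦ t ^ n) {c : ℕ} (hc : c ≠ 0) {R : ℝ} (hR : 1 ≤ R)
    {Y : ℕ → k} (hY : HasGrowth c R Y) {r : ℝ} (hr : 0 < r)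
    (hlow : ∀ s : ℕ → k, HasGrowth c R s → ∃ κ : ℝ, 0 < κ ∧
      ∀ m, s m ≠ 0 → κ * r ^ m ≤ ‖φ (s m)‖)
    {B ρ : ℝ} (hρ : 0 ≤ ρ) (hρr : ρ < r) (A : Finset ℕ) (b : ℕ) :
    ∀ᶠ m in Filter.atTop, ∀ q : Polynomial K, q.degree < A.card →
      (∀ a ∈ insert b A, ‖φ (Y (m + a)) - q.eval (φ (t ^ (m + a)))‖ ≤ B * ρ ^ m) →
      (Lagrange.interpolate A (fun a ↦ t ^ a) fun a ↦ Y (m + a)).eval (t ^ b) = Y (m + b) := by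
  set l : ℕ → k := fun a ↦ (Lagrange.basis A (fun a ↦ t ^ a) a).eval (t ^ b) with hl
  have hW : HasGrowth c R fun m ↦ Y (m + b) + (-1) * ∑ a ∈ A, l a * Y (m + a) :=
    (hY.shift hc hR b).add
      ((HasGrowth.sum A (by linarith) fun a _ ↦ (hY.shift hc hR a).const_mul (l a)).const_mul _)
  obtain ⟨κ, hκ, hκ'⟩ := hlow _ hW
  have hlim : Filter.Tendsto (fun m ↦ (1 + ∑ a ∈ A, ‖φ (l a)‖) * B * (ρ / r) ^ m) Filter.atTop
      (nhds ((1 + ∑ a ∈ A, ‖φ (l a)‖) * B * 0)) :=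
    (tendsto_pow_atTop_nhds_zero_of_lt_one (by positivity) ((div_lt_one hr).2 hρr)).const_mul _
  rw [mul_zero] at hlim
  filter_upwards [hlim.eventually_lt_const hκ] with m hm q hq happ
  have heval : (Lagrange.interpolate A (fun a ↦ t ^ a) fun a ↦ Y (m + a)).eval (t ^ b) =
      ∑ a ∈ A, l a * Y (m + a) := by
    simp [Lagrange.interpolate_apply, Polynomial.eval_finsetSum, hl, mul_comm]
  rw [heval]
  by_contra hne
  have h1 := hκ' m (by
    intro h0
    exact hne (by linear_combination -h0))
  have h2 : φ (Y (m + b) + (-1) * ∑ a ∈ A, l a * Y (m + a)) =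
      (φ (Y (m + b)) - q.eval (φ (t ^ (m + b)))) -
        ∑ a ∈ A, φ (l a) * (φ (Y (m + a)) - q.eval (φ (t ^ (m + a)))) := by
    have h3 := sum_basis_mul_eval (s := A) (v := fun a ↦ t ^ a) hinj.injOn φ (t ^ b) (φ (t ^ m)) hq
    simp only [← map_mul, ← pow_add] at h3
    rw [h3]
    simp only [mul_sub, Finset.sum_sub_distrib, map_add, map_mul, map_neg, map_one, map_sum, hl]
    ring
  have h4 : ‖φ (Y (m + b) + (-1) * ∑ a ∈ A, l a * Y (m + a))‖ ≤
      (1 + ∑ a ∈ A, ‖φ (l a)‖) * B * ρ ^ m := by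
    rw [h2, add_mul, add_mul, one_mul, Finset.sum_mul, Finset.sum_mul]
    refine (norm_sub_le _ _).trans (add_le_add (happ b (Finset.mem_insert_self _ _)) ?_)
    refine (norm_sum_le _ _).trans (Finset.sum_le_sum fun a ha ↦ ?_)
    rw [norm_mul, mul_assoc]
    gcongr
    exact happ a (Finset.mem_insert_of_mem ha)
  have h5 : (1 + ∑ a ∈ A, ‖φ (l a)‖) * B * ρ ^ m < κ * r ^ m := by
    rw [div_pow, mul_div_assoc', div_lt_iff₀ (by positivity)] at hm
    exact hm
  linarith

lemma Polynomial.eval_eval_map_comp {k : Type*} [CommRing k] (A : Polynomial (Polynomial k))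
    (g Q : Polynomial k) (x : k) :
    ((A.map (Polynomial.compRingHom g)).eval Q).eval x = A.evalEval (g.eval x) (Q.eval x) := by
  rw [← Polynomial.eval₂_evalRingHom, Polynomial.eval_map, ← Polynomial.coe_evalRingHom x,
    Polynomial.hom_eval₂]
  congr 1
  refine RingHom.ext fun p ↦ ?_
  simp [Polynomial.eval_comp]

lemma Polynomial.natDegree_eval_map_comp_le {A : Polynomial (Polynomial k)} {E N : ℕ}
    (hE : ∀ i, (A.coeff i).natDegree ≤ E) (c : k) {Q : Polynomial k} (hQ : Q.natDegree ≤ N) :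
    ((A.map (Polynomial.compRingHom (Polynomial.C c * Polynomial.X))).eval Q).natDegree ≤
      E + A.natDegree * N := by
  rw [Polynomial.eval_map, Polynomial.eval₂_eq_sum_range]
  refine Polynomial.natDegree_sum_le_of_forall_le _ _ fun i hi ↦ ?_
  refine Polynomial.natDegree_mul_le.trans (add_le_add ?_ ?_)
  · rw [Polynomial.coe_compRingHom_apply]
    refine Polynomial.natDegree_comp_le.trans ?_
    calc _ ≤ E * 1 := Nat.mul_le_mul (hE i) ((Polynomial.natDegree_C_mul_le _ _).trans Polynomial.natDegree_X_le)
      _ = E := mul_one E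
  · exact Polynomial.natDegree_pow_le.trans
      (Nat.mul_le_mul (Nat.lt_succ_iff.1 (Finset.mem_range.1 hi)) hQ)

lemma Polynomial.exists_natDegree_coeff_le (A : Polynomial (Polynomial k)) :
    ∃ E, ∀ i, (A.coeff i).natDegree ≤ E := by
  refine ⟨A.support.sup fun i ↦ (A.coeff i).natDegree, fun i ↦ ?_⟩
  by_cases hi : i ∈ A.support
  · exact Finset.le_sup (f := fun i ↦ (A.coeff i).natDegree) hi
  · simp [Polynomial.notMem_support_iff.1 hi]

end Interpolation

section Specialization

variable {k : Type*} [Field k] [NumberField k] {K : Type*} [NormedField K]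

/-- A monic polynomial over `k[X]` whose roots are power series at a place where `t` is small, and
which has a root in `k` after each substitution `X ↦ t ^ m`, has a root in `k[X]` after some
substitution `X ↦ c * X`. -/
theorem exists_polynomial_root_of_forall_pow {φ : k →+* K} {h : ℕ}
    (hφ : ∀ (w : k) (R : ℝ), w ≠ 0 → IsIntegral ℤ w → 1 ≤ R → (∀ σ : k →+* ℂ, ‖σ w‖ ≤ R) →
      (R ^ h)⁻¹ ≤ ‖φ w‖)
    {t : k} (ht : t ≠ 0) (hinj : Function.Injective fun n : ℕ ↦ t ^ n) (htφ : ‖φ t‖ < 1)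
    {Γ : Polynomial (Polynomial k)} (hΓ : Γ.Monic)
    (hsplit : ((Γ.map (Polynomial.mapRingHom φ)).map
      Polynomial.coeToPowerSeries.ringHom).Splits)
    {Y : ℕ → k} (hY : ∀ m, Γ.evalEval (t ^ m) (Y m) = 0) :
    ∃ c : k, c ≠ 0 ∧ ∃ Q : Polynomial k,
      (Γ.map (Polynomial.compRingHom (Polynomial.C c * Polynomial.X))).eval Q = 0 := by
  classical
  obtain ⟨E, hE⟩ := Γ.exists_natDegree_coeff_le
  have hD : Γ.natDegree ≠ 0 := by
    intro h0
    simpa [Polynomial.eq_one_of_monic_natDegree_zero hΓ h0] using hY 0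
  obtain ⟨c, hc, R, hR, hgrowth⟩ := HasGrowth.exists_eval_pow t E
  have hYg : HasGrowth c R Y :=
    HasGrowth.root hR (p := fun m ↦ Γ.map (Polynomial.evalRingHom (t ^ m)))
      (fun m ↦ hΓ.map _) (fun m ↦ hΓ.natDegree_map _)
      (fun j _ ↦ by simpa [Polynomial.coeff_map] using hgrowth _ (hE j))
      fun m ↦ by rw [Polynomial.map_evalRingHom_eval]; exact hY m
  obtain ⟨r, hr, hlow⟩ := HasGrowth.exists_le_norm φ hφ hc hR
  obtain ⟨J, hJ⟩ := exists_pow_lt_of_lt_one hr htφ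
  have hΓK := hΓ.map (Polynomial.mapRingHom φ)
  obtain ⟨S, hScard, hSdeg, B, hB, happ⟩ := exists_finset_branch_approx hΓK
    (by rwa [hΓ.natDegree_map]) hsplit J
  rw [hΓ.natDegree_map] at hScard hSdeg
  set N := Γ.natDegree * J with hN
  set M := N + (E + Γ.natDegree * N) with hM
  set L := Γ.natDegree * M + 1 with hL
  have hev : ∀ᶠ m in Filter.atTop, ∀ p ∈ (Finset.range L).powerset ×ˢ Finset.range L,
      ∀ q : Polynomial K, q.degree < p.1.card →
      (∀ a ∈ insert p.2 p.1,
        ‖φ (Y (m + a)) - q.eval (φ (t ^ (m + a)))‖ ≤ B * (‖φ t‖ ^ J) ^ m) →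
      (Lagrange.interpolate p.1 (fun a ↦ t ^ a) fun a ↦ Y (m + a)).eval (t ^ p.2) =
        Y (m + p.2) :=
    (Filter.eventually_all_finset _).2 fun p _ ↦
      eventually_eq_eval_interpolate hinj hc hR hYg hr hlow (by positivity) hJ p.1 p.2
  obtain ⟨m, hm⟩ := hev.exists
  have hcol : ∀ a : ℕ, ∃ q ∈ S,
      ‖φ (Y (m + a)) - q.eval (φ (t ^ (m + a)))‖ ≤ B * (‖φ t‖ ^ J) ^ m := by
    intro a
    obtain ⟨q, hq, hq'⟩ := happ (φ (t ^ (m + a))) (φ (Y (m + a)))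
      (by simpa using fun h0 ↦ absurd h0 ht)
      (by rw [map_pow, norm_pow]; exact pow_le_one₀ (norm_nonneg _) htφ.le)
      (by
        rw [Polynomial.map_mapRingHom_evalEval, hY, map_zero])
    refine ⟨q, hq, hq'.trans ?_⟩
    rw [map_pow, norm_pow, ← pow_mul, ← pow_mul, mul_comm J m]
    gcongr ?_ * ?_
    exact pow_le_pow_of_le_one (norm_nonneg _) htφ.le (Nat.mul_le_mul_right _ (Nat.le_add_right _ _))
  choose f hfS hf using hcol
  obtain ⟨q, hqS, hq⟩ := Finset.exists_lt_card_fiber_of_mul_lt_card_of_maps_to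
    (s := Finset.range L) (t := S) (f := f) (n := M) (fun a _ ↦ hfS a) (by
      rw [Finset.card_range, hL, Nat.lt_succ_iff]
      exact Nat.mul_le_mul_right _ hScard)
  set A := (Finset.range L).filter fun a ↦ f a = q with hA
  obtain ⟨A₀, hA₀, hA₀card⟩ := Finset.exists_subset_card_eq (s := A) (n := N) (by omega)
  have hAq : ∀ a ∈ A, ‖φ (Y (m + a)) - q.eval (φ (t ^ (m + a)))‖ ≤ B * (‖φ t‖ ^ J) ^ m := by
    intro a ha
    rw [← (Finset.mem_filter.1 ha).2]
    exact hf a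
  set Q := Lagrange.interpolate A₀ (fun a ↦ t ^ a) fun a ↦ Y (m + a) with hQ
  have hQA : ∀ b ∈ A, Q.eval (t ^ b) = Y (m + b) := by
    intro b hb
    refine hm (A₀, b) (Finset.mem_product.2 ⟨Finset.mem_powerset.2
      (hA₀.trans (Finset.filter_subset _ _)), (Finset.mem_filter.1 hb).1⟩) q ?_ ?_
    · rw [hA₀card]
      exact hSdeg q hqS
    · intro a ha
      rcases Finset.mem_insert.1 ha with rfl | ha
      · exact hAq _ hb
      · exact hAq a (hA₀ ha)
  have hQdeg : Q.natDegree ≤ N := by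
    have := Lagrange.degree_interpolate_lt (s := A₀) (v := fun a ↦ t ^ a) (fun a ↦ Y (m + a))
      hinj.injOn
    rw [hA₀card] at this
    exact Polynomial.natDegree_le_of_degree_le this.le
  refine ⟨t ^ m, pow_ne_zero _ ht, Q, ?_⟩
  refine Polynomial.eq_zero_of_natDegree_lt_card_of_eval_eq_zero' _ (A.image fun a ↦ t ^ a) ?_ ?_
  · intro x hx
    obtain ⟨b, hb, rfl⟩ := Finset.mem_image.1 hx
    have := hY (m + b)
    rw [← hQA b hb, pow_add] at this
    rw [Polynomial.eval_eval_map_comp]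
    simpa using this
  · rw [Finset.card_image_of_injective _ hinj]
    have := Polynomial.natDegree_eval_map_comp_le hE (t ^ m) hQdeg
    omega

end Specialization

section AffineEquation

variable {k : Type} [Field k]

/-- The affine equation `F(X, 1, Y)` as a polynomial in `Y` over `k[X]`. -/
def affineEquation (F : MvPolynomial (Fin 3) k) : Polynomial (Polynomial k) :=
  aeval ![Polynomial.C Polynomial.X, 1, Polynomial.X] F

lemma evalEval_affineEquation (F : MvPolynomial (Fin 3) k) (x y : k) :
    (affineEquation F).evalEval x y = eval ![x, 1, y] F := by
  rw [affineEquation, aeval_fin_three_eq_sum, Polynomial.evalEval_finsetSum, ← aeval_eq_eval,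
    aeval_fin_three_eq_sum]
  refine Finset.sum_congr rfl fun e _ ↦ ?_
  simp [Polynomial.evalEval_mul, Polynomial.evalEval_pow, Polynomial.evalEval_C]

lemma eval_map_affineEquation (F : MvPolynomial (Fin 3) k) (g Q : Polynomial k) :
    ((affineEquation F).map (Polynomial.compRingHom g)).eval Q = aeval ![g, 1, Q] F := by
  rw [affineEquation, aeval_fin_three_eq_sum, Polynomial.map_sum, Polynomial.eval_finsetSum,
    aeval_fin_three_eq_sum]
  refine Finset.sum_congr rfl fun e _ ↦ ?_
  simp

lemma Polynomial.evalEval_integralNormalization (A : Polynomial (Polynomial k))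
    (hA : A.natDegree ≠ 0) (x y : k) :
    A.integralNormalization.evalEval x (A.leadingCoeff.eval x * y) =
      A.leadingCoeff.eval x ^ (A.natDegree - 1) * A.evalEval x y := by
  rw [← Polynomial.eval₂_evalRingHom, ← Polynomial.coe_evalRingHom,
    Polynomial.integralNormalization_eval₂_leadingCoeff_mul (Nat.one_le_iff_ne_zero.2 hA)]

lemma Polynomial.evalEval_map_comp (A : Polynomial (Polynomial k)) (g : Polynomial k) (x y : k) :
    (A.map (Polynomial.compRingHom g)).evalEval x y = A.evalEval (g.eval x) y := by
  rw [Polynomial.evalEval, Polynomial.eval_eval_map_comp, Polynomial.eval_C]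

variable [CharZero k] {d : ℕ} {F : MvPolynomial (Fin 3) k}

lemma aeval_eq_zero_of_integralNormalization (hF : F.IsHomogeneous d)
    (hn : (affineEquation F).natDegree ≠ 0) {g Q : Polynomial k}
    (ha : (affineEquation F).leadingCoeff.comp g ≠ 0)
    (hQ : ((affineEquation F).integralNormalization.map (Polynomial.compRingHom g)).eval Q = 0) :
    aeval ![(affineEquation F).leadingCoeff.comp g * g, (affineEquation F).leadingCoeff.comp g, Q]
      F = 0 := by
  set a := (affineEquation F).leadingCoeff with hadef
  refine (mul_eq_zero (a := a.comp g).1 (Polynomial.funext fun x ↦ ?_)).resolve_left ha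
  rw [Polynomial.eval_mul, eval_aeval_fin_three, Polynomial.eval_zero, mul_eq_zero]
  by_cases hx : (a.comp g).eval x = 0
  · exact Or.inl hx
  right
  have h1 := congrArg (Polynomial.eval x) hQ
  rw [Polynomial.eval_eval_map_comp, Polynomial.eval_zero] at h1
  have h2 := Polynomial.evalEval_integralNormalization (affineEquation F) hn (g.eval x)
    (Q.eval x / (a.comp g).eval x)
  rw [← hadef, ← Polynomial.eval_comp, mul_div_cancel₀ _ hx, h1, eq_comm, mul_eq_zero] at h2
  have h3 := h2.resolve_left (pow_ne_zero _ hx)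
  rw [evalEval_affineEquation] at h3
  have h4 := IsHomogeneous.aeval_mul hF ((a.comp g).eval x)
    ![g.eval x, 1, Q.eval x / (a.comp g).eval x]
  rw [aeval_eq_eval, aeval_eq_eval, h3, mul_zero] at h4
  rw [← h4]
  congr 2
  funext i
  fin_cases i
  · simp [Polynomial.eval_comp]
  · simp
  · exact (mul_div_cancel₀ _ hx).symm

namespace IsSmoothPlaneCurve

lemma affineEquation_ne_zero (hd : 3 ≤ d) (hF : IsSmoothPlaneCurve d F) :
    affineEquation F ≠ 0 := by
  intro h0
  have h1 := eval_map_affineEquation F Polynomial.X 0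
  rw [h0, Polynomial.map_zero, Polynomial.eval_zero] at h1
  simpa using hF.mul_derivative_eq hd h1.symm 0 1

lemma aeval_ne_zero (hd : 3 ≤ d) (hF : IsSmoothPlaneCurve d F) {g a Q : Polynomial k}
    (ha : a ≠ 0) (hg : g.natDegree ≠ 0) : aeval ![a * g, a, Q] F ≠ 0 := by
  intro h0
  have h1 := hF.mul_derivative_eq hd h0 0 1
  simp only [Matrix.cons_val_zero, Matrix.cons_val_one, Polynomial.derivative_mul] at h1
  have h2 : a * a * Polynomial.derivative g = 0 := by linear_combination -h1
  rw [mul_eq_zero, or_iff_right (mul_ne_zero ha ha)] at h2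
  exact hg (Polynomial.derivative_eq_zero.1 h2)

lemma aeval_C_ne_zero (hd : 3 ≤ d) (hF : IsSmoothPlaneCurve d F) (x : k) :
    aeval ![Polynomial.C x, 1, Polynomial.X] F ≠ 0 := by
  intro h0
  simpa using hF.mul_derivative_eq hd h0 1 2

end IsSmoothPlaneCurve

end AffineEquation

section Main

variable {k : Type} [Field k]

lemma injective_pow_of_forall_pow_ne_one {t : k} (ht : t ≠ 0) (hroot : ∀ n, 0 < n → t ^ n ≠ 1) :
    Function.Injective fun n : ℕ ↦ t ^ n := by
  intro a b hab
  wlog hle : a ≤ b generalizing a b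
  · exact (this hab.symm (le_of_not_ge hle)).symm
  obtain ⟨c, rfl⟩ := Nat.exists_eq_add_of_le hle
  by_contra hne
  refine hroot c (Nat.pos_of_ne_zero fun h0 ↦ hne (by simp [h0])) ?_
  have : t ^ a * t ^ c = t ^ a * 1 := by
    rw [← pow_add, mul_one]
    exact hab.symm
  exact mul_left_cancel₀ (pow_ne_zero _ ht) this

/-- Substituting `X ^ e` for `X` turns a polynomial over `k[X]` into one whose roots are power
series. -/
lemma exists_splits_map_comp {K : Type*} [Field K] [IsAlgClosed K] [CharZero K] (φ : k →+* K)
    {G : Polynomial (Polynomial k)} (hG : G.Monic) (τ : k) :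
    ∃ e : ℕ, e ≠ 0 ∧ (((G.map (Polynomial.compRingHom
      (Polynomial.C τ * Polynomial.X ^ e))).map (Polynomial.mapRingHom φ)).map
        Polynomial.coeToPowerSeries.ringHom).Splits := by
  obtain ⟨e, he, h⟩ := exists_splits_map_expandHom (K := K) G.natDegree
    (((G.map (Polynomial.compRingHom (Polynomial.C τ * Polynomial.X))).map
      (Polynomial.mapRingHom φ)).map Polynomial.coeToPowerSeries.ringHom)
    (((hG.map _).map _).map _)
    (by rw [((hG.map _).map _).natDegree_map, (hG.map _).natDegree_map, hG.natDegree_map])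
  refine ⟨e, he, ?_⟩
  rw [Polynomial.map_map, Polynomial.map_map, Polynomial.map_map] at h
  rw [Polynomial.map_map, Polynomial.map_map]
  convert h using 2
  refine Polynomial.ringHom_ext (fun a ↦ ?_) ?_
  · simp [expandHom_apply, PowerSeries.expand_C]
  · simp [expandHom_apply, PowerSeries.expand_C, PowerSeries.expand_X]

variable [NumberField k] {d : ℕ} {F : MvPolynomial (Fin 3) k} {τ t : k} {z : ℕ → k}

namespace IsSmoothPlaneCurve

lemma pow_ne_one_of_forall_eval_eq_zero (hd : 3 ≤ d) (hF : IsSmoothPlaneCurve d F)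
    (hz : ∀ n, eval ![τ * t ^ n, 1, z n] F = 0)
    (hinj : Function.Injective fun n ↦ (τ * t ^ n, z n)) {n : ℕ} (hn : 0 < n) : t ^ n ≠ 1 := by
  intro h1
  refine hF.aeval_C_ne_zero hd τ ?_
  have hx : ∀ j, τ * t ^ (n * j) = τ := fun j ↦ by rw [pow_mul, h1, one_pow, mul_one]
  have hinj' : Function.Injective fun j ↦ z (n * j) := by
    intro i j hij
    have := @hinj (n * i) (n * j) (Prod.ext ((hx i).trans (hx j).symm) hij)
    exact Nat.eq_of_mul_eq_mul_left hn this
  refine Polynomial.eq_zero_of_infinite_isRoot _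
    ((Set.infinite_range_of_injective hinj').mono ?_)
  rintro _ ⟨j, rfl⟩
  have := hz (n * j)
  rw [hx] at this
  rw [Set.mem_ofPred_eq, Polynomial.IsRoot, eval_aeval_fin_three, ← this]
  congr 2
  funext i
  fin_cases i <;> simp

lemma natDegree_affineEquation_ne_zero (hd : 3 ≤ d) (hF : IsSmoothPlaneCurve d F)
    (hz : ∀ n, eval ![τ * t ^ n, 1, z n] F = 0)
    (hinj : Function.Injective fun n ↦ τ * t ^ n) : (affineEquation F).natDegree ≠ 0 := by
  intro h0
  refine hF.affineEquation_ne_zero hd ?_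
  rw [Polynomial.eq_C_of_natDegree_eq_zero h0]
  refine (congrArg Polynomial.C ?_).trans Polynomial.C_0
  refine Polynomial.eq_zero_of_infinite_isRoot _ ((Set.infinite_range_of_injective hinj).mono ?_)
  rintro _ ⟨n, rfl⟩
  have := hz n
  rwa [← evalEval_affineEquation, Polynomial.eq_C_of_natDegree_eq_zero h0,
    Polynomial.evalEval_C] at this

/-- A smooth plane curve of positive genus contains no infinite sequence of distinct rational points
`(τ * t ^ n : 1 : z n)`. -/
theorem not_forall_eval_eq_zero (hd : 3 ≤ d) (hF : IsSmoothPlaneCurve d F) (hτ : τ ≠ 0)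
    (ht : t ≠ 0) (hz : ∀ n, eval ![τ * t ^ n, 1, z n] F = 0)
    (hinj : Function.Injective fun n ↦ (τ * t ^ n, z n)) : False := by
  have hroot : ∀ n, 0 < n → t ^ n ≠ 1 := fun n hn ↦
    hF.pow_ne_one_of_forall_eval_eq_zero hd hz hinj hn
  have htinj := injective_pow_of_forall_pow_ne_one ht hroot
  have hn := hF.natDegree_affineEquation_ne_zero hd hz ((mul_right_injective₀ hτ).comp htinj)
  have hp := hF.affineEquation_ne_zero hd
  set p := affineEquation F with hpdef
  have hG : p.integralNormalization.Monic := Polynomial.monic_integralNormalization hp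
  obtain ⟨K, _, _, _, φ, htφ, h, hφ⟩ := exists_place_norm_lt_one ht hroot
  obtain ⟨e, he, hsplit⟩ := exists_splits_map_comp φ hG τ
  obtain ⟨c, hc, Q, hQ⟩ := exists_polynomial_root_of_forall_pow hφ ht htinj htφ (hG.map _) hsplit
    (Y := fun m ↦ p.leadingCoeff.eval (τ * t ^ (m * e)) * z (m * e)) fun m ↦ by
      rw [Polynomial.evalEval_map_comp]
      have hX : (Polynomial.C τ * Polynomial.X ^ e).eval (t ^ m) = τ * t ^ (m * e) := by
        simp [pow_mul]
      rw [hX, Polynomial.evalEval_integralNormalization p hn, evalEval_affineEquation, hz, mul_zero]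
  set g : Polynomial k := Polynomial.C (τ * c ^ e) * Polynomial.X ^ e with hg
  have hgdeg : g.natDegree = e :=
    Polynomial.natDegree_C_mul_X_pow _ _ (mul_ne_zero hτ (pow_ne_zero _ hc))
  have hcomp : (Polynomial.compRingHom (Polynomial.C c * Polynomial.X)).comp
      (Polynomial.compRingHom (Polynomial.C τ * Polynomial.X ^ e)) = Polynomial.compRingHom g := by
    refine Polynomial.ringHom_ext (fun a ↦ ?_) ?_
    · simp
    · simp [hg, mul_pow, mul_assoc]
  rw [Polynomial.map_map, hcomp] at hQ
  have ha : p.leadingCoeff.comp g ≠ 0 := by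
    rw [Ne, Polynomial.comp_eq_zero_iff, not_or]
    refine ⟨Polynomial.leadingCoeff_ne_zero.2 hp, fun h0 ↦ he ?_⟩
    rw [← hgdeg, h0.2, Polynomial.natDegree_C]
  exact hF.aeval_ne_zero hd ha (hgdeg.trans_ne he)
    (aeval_eq_zero_of_integralNormalization hF.1 hn ha hQ)

end IsSmoothPlaneCurve

end Main

/-- **Rational geometric progressions on smooth plane curves are finite.**
Let `C : F(X,Y,Z) = 0` be a smooth projective plane curve of degree `d ≥ 3` over a number
field `k` (so of genus `g ≥ 1`).  Then there is no infinite rational geometric progression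
sequence on `C`: there is no infinite sequence of pairwise distinct `k`-rational points
`P i = (x i : 1 : z i)` on `C` (normalized affinely at `Y = 1`, all coordinates in `k`)
whose `x`-coordinates form a geometric progression `x i = t' * t ^ (i+1)` with `t, t' ∈ k*`. -/
theorem rational_geometric_progression_on_smooth_plane_curve_is_finite
    (k : Type) [Field k] [NumberField k]
    (d : ℕ) (hd : 3 ≤ d)
    (F : MvPolynomial (Fin 3) k) (hF : IsSmoothPlaneCurve d F)
    (t t' : k) (ht : t ≠ 0) (ht' : t' ≠ 0)
    (P : ℕ → Fin 3 → k) (hinj : Function.Injective P)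
    (honC : ∀ i, eval (P i) F = 0)
    (hx : ∀ i, P i 0 = t' * t ^ (i + 1))
    (hy : ∀ i, P i 1 = 1) :
    False := by
  have hP : ∀ n, P n = ![t' * t * t ^ n, 1, P n 2] := by
    intro n
    funext i
    fin_cases i
    · simp only [Fin.zero_eta, hx, Matrix.cons_val_zero]
      ring
    · simpa using hy n
    · simp
  refine hF.not_forall_eval_eq_zero hd (mul_ne_zero ht' ht) ht (z := fun n ↦ P n 2)
    (fun n ↦ hP n ▸ honC n) fun m n hmn ↦ hinj ?_
  obtain ⟨h0, h2⟩ := Prod.ext_iff.1 hmn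
  simp only at h0 h2
  rw [hP m, hP n, h0, h2]
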